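/- arXiv:1408.2932 — 2 statements merged into one kernel-verified Lean document; each statement's English description precedes it below -/
import Mathlib

section
/- For n ∈ ℕ let γ_n : [0,ℓ_n] → ℝ² and γ : [0,ℓ] → ℝ² be natural parametrizations (i.e. |γ_n'| = 1 and |γ'| = 1 a.e.) of closed simple Lipschitz curves C_n and C, each positively oriented. Suppose that C_n → C in the Hausdorff metric, that H¹(C_n) → H¹(C), and that γ_n(0) → γ(0) as n → ∞. Then for every τ ∈ (0,ℓ), the arcs γ_n([0,τ]) converge to γ([0,τ]) in the Hausdorff metric as n → ∞. -/
open MeasureTheory Set Filter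
open scoped Topology ENNReal NNReal

noncomputable section

/-- `γ` is a natural (unit-speed) parametrization on `[0,ℓ]` of the closed simple Lipschitz
curve `C ⊆ ℂ ≃ ℝ²`: it is `1`-Lipschitz on `[0,ℓ]`, closes up, is injective on `[0,ℓ)`,
has image `C`, and has derivative of norm one a.e. -/
def NaturalClosedParam (ℓ : ℝ) (γ : ℝ → ℂ) (C : Set ℂ) : Prop :=
  0 < ℓ ∧ LipschitzOnWith 1 γ (Set.Icc 0 ℓ) ∧ γ 0 = γ ℓ ∧ Set.InjOn γ (Set.Ico 0 ℓ) ∧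
    C = γ '' Set.Icc 0 ℓ ∧
    (∀ᵐ t ∂(volume.restrict (Set.Ioo 0 ℓ)), ∃ g : ℂ, HasDerivAt γ g t ∧ ‖g‖ = 1)

/-- The parametrization `γ` of the closed simple curve `C` is positively oriented:
for some point `p` in the bounded connected component of `ℂ \ C` there is a continuous
angle function `θ` with `γ t - p = |γ t - p| e^{i θ t}` and total increment `2π`. -/
def PositivelyOriented (ℓ : ℝ) (γ : ℝ → ℂ) (C : Set ℂ) : Prop :=
  ∃ p : ℂ, p ∉ C ∧ Bornology.IsBounded (connectedComponentIn Cᶜ p) ∧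
    ∃ θ : ℝ → ℝ, ContinuousOn θ (Set.Icc 0 ℓ) ∧
      (∀ t ∈ Set.Icc 0 ℓ, γ t - p = (‖γ t - p‖ : ℂ) * Complex.exp (θ t * Complex.I)) ∧
      θ ℓ - θ 0 = 2 * Real.pi

/-- `f` has a continuous angle function on `ℝ` whose increment over `[0,T]` is `w`. -/
def Wind (f : ℝ → ℂ) (T w : ℝ) : Prop :=
  ∃ θ : ℝ → ℝ, Continuous θ ∧ (∀ t, f t = (‖f t‖ : ℂ) * Complex.exp (θ t * Complex.I)) ∧
    θ T - θ 0 = w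

lemma Wind.perturb {f f' : ℝ → ℂ} {T w : ℝ} (hf : Continuous f) (hf' : Continuous f')
    (hc : ∀ t, ‖f' t - f t‖ < ‖f t‖) (h1 : f 0 = f T) (h2 : f' 0 = f' T) (hw : Wind f T w) :
    Wind f' T w := by
  obtain ⟨θ, hθ, he, hinc⟩ := hw
  have hne : ∀ t, f t ≠ 0 := fun t h0 => by
    have := hc t
    rw [h0] at this
    simp at this
    exact absurd this (not_lt.2 (norm_nonneg _))
  have hre : ∀ t, 0 < (f' t / f t).re := by
    intro t
    have h3 : ‖f' t / f t - 1‖ < 1 := by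
      have : f' t / f t - 1 = (f' t - f t) / f t := by field_simp [hne t]
      rw [this, norm_div, div_lt_one (norm_pos_iff.2 (hne t))]
      exact hc t
    have h4 := (Complex.abs_re_le_norm (f' t / f t - 1)).trans_lt h3
    rw [abs_lt] at h4
    simp at h4
    simpa using h4.1
  refine ⟨fun t => θ t + Complex.arg (f' t / f t), ?_, ?_, ?_⟩
  · refine hθ.add ?_
    rw [continuous_iff_continuousAt]
    intro t
    exact ContinuousAt.comp (g := Complex.arg) (f := fun t => f' t / f t)
      (Complex.continuousAt_arg (Or.inl (hre t)))
      (hf'.continuousAt.div hf.continuousAt (hne t))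
  · intro t
    have e1 : f' t = f t * (f' t / f t) := by field_simp [hne t]
    have e2 := Complex.norm_mul_exp_arg_mul_I (f' t / f t)
    calc f' t = f t * (f' t / f t) := e1
      _ = ((‖f t‖ : ℂ) * Complex.exp (θ t * Complex.I)) *
          ((‖f' t / f t‖ : ℂ) * Complex.exp (Complex.arg (f' t / f t) * Complex.I)) := by
            rw [e2, ← he t]
      _ = ((‖f t‖ * ‖f' t / f t‖ : ℝ) : ℂ) *
          Complex.exp ((θ t + Complex.arg (f' t / f t) : ℝ) * Complex.I) := by
            push_cast
            rw [add_mul, Complex.exp_add]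
            ring
      _ = _ := by
            rw [← norm_mul, ← e1]
  · simp only [h1, h2]
    linarith

lemma Wind.unique {f : ℝ → ℂ} {T w w' : ℝ} (hne : ∀ t, f t ≠ 0) (hw : Wind f T w)
    (hw' : Wind f T w') : w = w' := by
  obtain ⟨θ, hθ, he, hinc⟩ := hw
  obtain ⟨θ', hθ', he', hinc'⟩ := hw'
  have h1 : ∀ t, ∃ k : ℤ, (θ t - θ' t) / (2 * Real.pi) = k := by
    intro t
    have h2 : Complex.exp (θ t * Complex.I) = Complex.exp (θ' t * Complex.I) := by
      have h3 := (he t).symm.trans (he' t)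
      exact mul_left_cancel₀ (by simpa using hne t) h3
    obtain ⟨k, hk⟩ := Complex.exp_eq_exp_iff_exists_int.1 h2
    refine ⟨k, ?_⟩
    have h4 := congrArg Complex.im hk
    simp at h4
    rw [h4]
    field_simp
    ring
  choose k hk using h1
  have hkc : Continuous k := by
    rw [Int.isClosedEmbedding_coe_real.isInducing.continuous_iff]
    have : ((fun x : ℤ => (x : ℝ)) ∘ k) = fun t => (θ t - θ' t) / (2 * Real.pi) := by
      ext t
      simp [hk t]
    rw [this]
    fun_prop
  have h5 : k T = k 0 := PreconnectedSpace.constant inferInstance hkc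
  have h6 := hk T
  rw [h5, ← hk 0] at h6
  have : θ T - θ' T = θ 0 - θ' 0 := by
    have := Real.pi_pos
    field_simp at h6
    exact h6
  linarith

/-- A continuous nonvanishing function on the plane has winding number zero on circles. -/
lemma wind_circle_zero {G : ℂ → ℂ} (hG : Continuous G) (h1 : ∀ z, ‖G z‖ = 1) (p : ℂ) (R : ℝ)
    (hR : 0 ≤ R) :
    Wind (fun t : ℝ => G (p + R * Complex.exp (t * Complex.I))) (2 * Real.pi) 0 := by
  have huc := (isCompact_closedBall p R).uniformContinuousOn_of_continuous hG.continuousOn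
  rw [Metric.uniformContinuousOn_iff] at huc
  obtain ⟨δ, hδ, hd⟩ := huc 1 one_pos
  have hper : ∀ r : ℝ, G (p + r * Complex.exp ((0 : ℝ) * Complex.I)) =
      G (p + r * Complex.exp ((2 * Real.pi : ℝ) * Complex.I)) := by
    intro r
    push_cast
    rw [Complex.exp_two_pi_mul_I]
    simp
  have key : ∀ n : ℕ, ∀ r : ℝ, 0 ≤ r → r ≤ R → r ≤ n * (δ / 2) →
      Wind (fun t : ℝ => G (p + r * Complex.exp (t * Complex.I))) (2 * Real.pi) 0 := by
    intro n
    induction n with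
    | zero =>
      intro r h0 _ h2
      have : r = 0 := by
        simp at h2
        linarith
      subst this
      refine ⟨fun _ => Complex.arg (G p), continuous_const, ?_, by simp⟩
      intro t
      simp [Complex.norm_mul_exp_arg_mul_I]
    | succ n ih =>
      intro r h0 hr h2
      have h3 := ih (max 0 (r - δ / 2)) (le_max_left _ _) (max_le hR (by linarith))
        (max_le (by positivity) (by push_cast at h2; linarith))
      refine Wind.perturb (by fun_prop) (by fun_prop) ?_ (hper _) (hper _) h3
      intro t
      rw [h1, ← dist_eq_norm]
      have hn : ∀ s : ℝ, 0 ≤ s → s ≤ R → p + s * Complex.exp (t * Complex.I) ∈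
          Metric.closedBall p R := by
        intro s hs hs'
        simp [Complex.norm_exp_ofReal_mul_I, abs_of_nonneg hs, hs']
      apply hd _ (hn r h0 hr) _ (hn _ (le_max_left _ _) (max_le hR (by linarith)))
      rw [dist_eq_norm]
      have : p + r * Complex.exp (t * Complex.I) -
          (p + (max 0 (r - δ / 2) : ℝ) * Complex.exp (t * Complex.I)) =
          ((r - max 0 (r - δ / 2) : ℝ) : ℂ) * Complex.exp (t * Complex.I) := by
        push_cast
        ring
      rw [this, norm_mul, Complex.norm_exp_ofReal_mul_I, mul_one, Complex.norm_real,
        Real.norm_eq_abs, abs_lt]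
      constructor
      · have : max 0 (r - δ / 2) ≤ r := max_le h0 (by linarith)
        linarith
      · have := le_max_right 0 (r - δ / 2)
        linarith
  obtain ⟨n, hn⟩ := exists_nat_ge (R / (δ / 2))
  exact key n R hR le_rfl (by rwa [div_le_iff₀ (by positivity)] at hn)

/-- Constant extension of `γ` from `[0,ℓ]` to `ℝ`. -/
def cext (ℓ : ℝ) {E : Type*} (γ : ℝ → E) (t : ℝ) : E := γ (max 0 (min ℓ t))

lemma clamp_mem {ℓ : ℝ} (hℓ : 0 < ℓ) (t : ℝ) : max 0 (min ℓ t) ∈ Icc 0 ℓ :=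
  ⟨le_max_left _ _, max_le hℓ.le (min_le_left _ _)⟩

lemma cext_eq {ℓ : ℝ} {E : Type*} (γ : ℝ → E) {t : ℝ} (ht : t ∈ Icc 0 ℓ) : cext ℓ γ t = γ t := by
  simp [cext, min_eq_right ht.2, max_eq_right ht.1]

lemma cext_of_ge {ℓ : ℝ} (hℓ : 0 < ℓ) {E : Type*} (γ : ℝ → E) {t : ℝ} (ht : ℓ ≤ t) :
    cext ℓ γ t = γ ℓ := by
  simp [cext, min_eq_left ht, max_eq_right hℓ.le]

lemma cext_of_le {ℓ : ℝ} {E : Type*} (γ : ℝ → E) {t : ℝ} (ht : t ≤ 0) :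
    cext ℓ γ t = γ 0 := by
  simp [cext, ht]

lemma cext_mem {ℓ : ℝ} (hℓ : 0 < ℓ) {E : Type*} (γ : ℝ → E) (t : ℝ) :
    cext ℓ γ t ∈ γ '' Icc 0 ℓ := ⟨_, clamp_mem hℓ t, rfl⟩

lemma cext_continuous {ℓ : ℝ} (hℓ : 0 < ℓ) {E : Type*} [TopologicalSpace E] {γ : ℝ → E}
    (h : ContinuousOn γ (Icc 0 ℓ)) : Continuous (cext ℓ γ) :=
  h.comp_continuous (f := fun t : ℝ => max 0 (min ℓ t)) (by fun_prop) (clamp_mem hℓ)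

lemma Wind.shrink {f : ℝ → ℂ} {ℓ T w : ℝ} (hf : ∀ t, ℓ ≤ t → f t = f ℓ) (hℓT : ℓ ≤ T)
    (hne : f ℓ ≠ 0) (hw : Wind f T w) : Wind f ℓ w := by
  obtain ⟨θ, hθ, he, hinc⟩ := hw
  have hF : ∀ t, f (ℓ + max t 0) = f ℓ := fun t => hf _ (by simp)
  have h1 : Wind (fun t => f (ℓ + max t 0)) (T - ℓ) (θ T - θ ℓ) := by
    refine ⟨fun t => θ (ℓ + max t 0), by fun_prop, fun t => he _, ?_⟩
    simp [hℓT]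
  have h2 : Wind (fun t => f (ℓ + max t 0)) (T - ℓ) 0 := by
    refine ⟨fun t => θ ℓ, by fun_prop, fun t => ?_, by simp⟩
    simp only [hF t]
    exact he ℓ
  have h3 := h1.unique (fun t => by rw [hF t]; exact hne) h2
  exact ⟨θ, hθ, he, by linarith⟩

lemma Wind.of_on {ℓ T w : ℝ} (hℓ : 0 < ℓ) (hT : ℓ ≤ T) {γ : ℝ → ℂ} {p : ℂ} {θ : ℝ → ℝ}
    (hθ : ContinuousOn θ (Icc 0 ℓ))
    (he : ∀ t ∈ Icc 0 ℓ, γ t - p = (‖γ t - p‖ : ℂ) * Complex.exp (θ t * Complex.I))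
    (hi : θ ℓ - θ 0 = w) : Wind (fun t => cext ℓ γ t - p) T w := by
  refine ⟨cext ℓ θ, cext_continuous hℓ hθ, fun t => he _ (clamp_mem hℓ t), ?_⟩
  rw [cext_of_ge hℓ _ hT, cext_of_le _ le_rfl, hi]

lemma component_closed {C : Set ℂ} {p x : ℂ} (hx : x ∈ closure (connectedComponentIn Cᶜ p))
    (hxC : x ∉ C) (hp : p ∉ C) : x ∈ connectedComponentIn Cᶜ p := by
  have h1 : IsPreconnected (insert x (connectedComponentIn Cᶜ p)) :=
    isPreconnected_connectedComponentIn.subset_closure (subset_insert _ _)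
      (insert_subset hx subset_closure)
  exact h1.subset_connectedComponentIn (mem_insert_of_mem _ (mem_connectedComponentIn hp))
    (insert_subset hxC (connectedComponentIn_subset _ _)) (mem_insert _ _)

/-- The winding number is constant on components of the complement. -/
lemma wind_component {g : ℝ → ℂ} (hg : Continuous g) {C : Set ℂ} (hC : IsClosed C)
    (hgC : ∀ t, g t ∈ C) {T w : ℝ} (h0 : g 0 = g T) {p q : ℂ} (hp : p ∉ C)
    (hq : q ∈ connectedComponentIn Cᶜ p) (hw : Wind (fun t => g t - p) T w) :
    Wind (fun t => g t - q) T w := by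
  have hmv : ∀ a b : ℂ, dist a b < Metric.infDist a C → Wind (fun t => g t - a) T w →
      Wind (fun t => g t - b) T w := by
    intro a b hab ha
    refine ha.perturb (by fun_prop) (by fun_prop) (fun t => ?_) (by simp [h0]) (by simp [h0])
    have h1 : g t - b - (g t - a) = a - b := by ring
    have h2 := Metric.infDist_le_dist_of_mem (x := a) (hgC t)
    rw [dist_comm, dist_eq_norm] at h2
    rw [h1, ← dist_eq_norm]
    exact hab.trans_le h2
  have hpos : ∀ a, a ∉ C → 0 < Metric.infDist a C := fun a ha =>
    (hC.notMem_iff_infDist_pos ⟨_, hgC 0⟩).1 ha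
  have hsub : connectedComponentIn Cᶜ p ⊆ {a | a ∉ C ∧ Wind (fun t => g t - a) T w} := by
    refine (isPreconnected_connectedComponentIn).subset_of_closure_inter_subset ?_ ?_ ?_
    · rw [Metric.isOpen_iff]
      rintro a ⟨ha, hwa⟩
      refine ⟨Metric.infDist a C, hpos a ha, fun b hb => ?_⟩
      rw [Metric.mem_ball, dist_comm] at hb
      refine ⟨fun hbC => ?_, hmv a b hb hwa⟩
      exact absurd (Metric.infDist_le_dist_of_mem hbC) (not_le.2 hb)
    · exact ⟨p, mem_connectedComponentIn hp, hp, hw⟩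
    · rintro b ⟨hb, hbU⟩
      have hbC : b ∉ C := connectedComponentIn_subset _ _ hbU
      refine ⟨hbC, ?_⟩
      obtain ⟨a, ⟨haC, ha⟩, hab⟩ := Metric.mem_closure_iff.1 hb (Metric.infDist b C / 2)
        (half_pos (hpos b hbC))
      refine hmv a b ?_ ha
      have := Metric.infDist_le_infDist_add_dist (x := b) (y := a) (s := C)
      rw [dist_comm]
      linarith
  exact (hsub hq).2

/-- A simple closed curve cannot have winding number `1` about one point and `-1` about
another one. -/
lemma not_both {ℓ : ℝ} (hℓ : 0 < ℓ) {γ : ℝ → ℂ} (hc : ContinuousOn γ (Icc 0 ℓ))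
    (hcl : γ 0 = γ ℓ) (hinj : InjOn γ (Ico 0 ℓ)) {p q : ℂ} (hp : p ∉ γ '' Icc 0 ℓ)
    (hq : q ∉ γ '' Icc 0 ℓ)
    (hb : Bornology.IsBounded (connectedComponentIn (γ '' Icc 0 ℓ)ᶜ p))
    (hwp : Wind (fun t => cext ℓ γ t - p) ℓ (2 * Real.pi))
    (hwq : Wind (fun t => cext ℓ γ t - q) ℓ (-(2 * Real.pi))) : False := by
  set C := γ '' Icc 0 ℓ with hCdef
  have hCc : IsCompact C := isCompact_Icc.image_of_continuousOn hc
  have hCcl : IsClosed C := hCc.isClosed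
  set U := connectedComponentIn Cᶜ p with hU
  have hUo : IsOpen U := hCcl.isOpen_compl.connectedComponentIn
  have hpU : p ∈ U := mem_connectedComponentIn hp
  have hgc := cext_continuous hℓ hc
  have hg0 : cext ℓ γ 0 = cext ℓ γ ℓ := by
    rw [cext_of_ge hℓ _ le_rfl, cext_of_le _ le_rfl, hcl]
  have hpi := Real.pi_pos
  have hqU : q ∉ U := by
    intro hqU
    have h1 := wind_component hgc hCcl (cext_mem hℓ γ) hg0 hp hqU hwp
    have h2 := h1.unique (fun t h => hq (by rw [← sub_eq_zero.1 h]; exact cext_mem hℓ γ t)) hwq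
    linarith
  have hfr : frontier U ⊆ C := by
    intro z hz
    by_contra hzC
    have := component_closed (frontier_subset_closure hz) hzC hp
    rw [hUo.frontier_eq] at hz
    exact hz.2 this
  have hqcl : q ∉ closure U := fun h => hqU (component_closed h hq hp)
  obtain ⟨θ, hθ, he, hi⟩ := hwp
  obtain ⟨θ', hθ', he', hi'⟩ := hwq
  -- descend the sum of the angles to `C`
  let π0 : Icc 0 ℓ → C := fun t => ⟨γ t, t, t.2, rfl⟩
  have hπc : Continuous π0 := (continuousOn_iff_continuous_domRestrict.1 hc).subtype_mk _
  have hπs : Function.Surjective π0 := by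
    rintro ⟨z, t, ht, rfl⟩
    exact ⟨⟨t, ht⟩, rfl⟩
  have hπq : Topology.IsQuotientMap π0 := hπc.isClosedMap.isQuotientMap hπc hπs
  have hend : θ ℓ + θ' ℓ = θ 0 + θ' 0 := by linarith
  have hwd : ∀ s ∈ Icc 0 ℓ, ∀ t ∈ Icc 0 ℓ, γ s = γ t → θ s + θ' s = θ t + θ' t := by
    have hz : ∀ t ∈ Icc 0 ℓ, ∃ s ∈ Ico 0 ℓ, γ s = γ t ∧ θ s + θ' s = θ t + θ' t := by
      intro t ht
      rcases ht.2.lt_or_eq with h | h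
      · exact ⟨t, ⟨ht.1, h⟩, rfl, rfl⟩
      · subst h
        exact ⟨0, ⟨le_rfl, hℓ⟩, hcl, hend.symm⟩
    intro s hs t ht hst
    obtain ⟨s', hs', h1, h2⟩ := hz s hs
    obtain ⟨t', ht', h3, h4⟩ := hz t ht
    have : s' = t' := hinj hs' ht' (by rw [h1, h3, hst])
    rw [← h2, ← h4, this]
  let iv : C → Icc 0 ℓ := Function.surjInv hπs
  let φ0 : C → ℝ := fun z => θ (iv z) + θ' (iv z)
  have hφ0 : ∀ t : Icc 0 ℓ, φ0 (π0 t) = θ t + θ' t := by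
    intro t
    have h1 := Function.surjInv_eq hπs (π0 t)
    exact hwd _ (iv (π0 t)).2 _ t.2 (congrArg Subtype.val h1)
  have hφ0c : Continuous φ0 := by
    rw [hπq.continuous_iff]
    have : φ0 ∘ π0 = fun t : Icc 0 ℓ => θ t + θ' t := funext hφ0
    rw [this]
    fun_prop
  obtain ⟨φ, hφ⟩ := ContinuousMap.exists_restrict_eq hCcl ⟨φ0, hφ0c⟩
  have hφγ : ∀ t ∈ Icc 0 ℓ, φ (γ t) = θ t + θ' t := by
    intro t ht
    have := congrArg (fun f : C(C, ℝ) => f (π0 ⟨t, ht⟩)) hφ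
    simp only [ContinuousMap.restrict_apply, ContinuousMap.coe_mk] at this
    rw [hφ0] at this
    exact this
  classical
  let G : ℂ → ℂ := fun z => if z ∈ U then
    Complex.exp (φ z * Complex.I) * ((‖z - q‖ : ℂ) / (z - q)) else (z - p) / (‖z - p‖ : ℂ)
  have hGc : Continuous G := by
    refine continuous_if ?_ ?_ ?_
    · intro z hz
      obtain ⟨t, ht, rfl⟩ := hfr hz
      have e1 := he t
      have e2 := he' t
      simp only [cext_eq γ ht] at e1 e2
      have n1 : γ t - p ≠ 0 := fun h => hp (by rw [← sub_eq_zero.1 h]; exact ⟨t, ht, rfl⟩)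
      have n2 : γ t - q ≠ 0 := fun h => hq (by rw [← sub_eq_zero.1 h]; exact ⟨t, ht, rfl⟩)
      have n1' : (‖γ t - p‖ : ℂ) ≠ 0 := by simpa using n1
      have n2' : (‖γ t - q‖ : ℂ) ≠ 0 := by simpa using n2
      rw [hφγ t ht, mul_div_assoc', div_eq_div_iff n2 n1']
      push_cast
      rw [add_mul, Complex.exp_add]
      conv_rhs => rw [e1, e2]
      ring
    · have : ∀ z ∈ closure {a | a ∈ U}, z - q ≠ 0 := fun z hz h =>
        hqcl (by rw [← sub_eq_zero.1 h]; exact hz)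
      fun_prop (disch := assumption)
    · have h3 : closure {a | a ∉ U} = Uᶜ := hUo.isClosed_compl.closure_eq
      rw [h3]
      have : ∀ z ∈ Uᶜ, (‖z - p‖ : ℂ) ≠ 0 := fun z hz h =>
        hz (by
          have : z - p = 0 := by simpa using h
          rw [sub_eq_zero.1 this]; exact hpU)
      fun_prop (disch := assumption)
  have hG1 : ∀ z, ‖G z‖ = 1 := by
    intro z
    by_cases hz : z ∈ U
    · have : z - q ≠ 0 := fun h => hqU (by rw [← sub_eq_zero.1 h]; exact hz)
      simp only [G, if_pos hz]
      rw [norm_mul, Complex.norm_exp_ofReal_mul_I, norm_div, Complex.norm_real, norm_norm,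
        div_self (norm_ne_zero_iff.2 this), one_mul]
    · have : z - p ≠ 0 := fun h => hz (by rw [sub_eq_zero.1 h]; exact hpU)
      simp only [G, if_neg hz]
      rw [norm_div, Complex.norm_real, norm_norm, div_self (norm_ne_zero_iff.2 this)]
  obtain ⟨R, hR0, hR⟩ := hb.subset_ball_lt 0 p
  have h1 := wind_circle_zero hGc hG1 p R hR0.le
  have h2 : Wind (fun t : ℝ => G (p + R * Complex.exp (t * Complex.I))) (2 * Real.pi)
      (2 * Real.pi) := by
    refine ⟨fun t => t, continuous_id, fun t => ?_, by simp⟩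
    rw [hG1]
    have hn : p + R * Complex.exp (t * Complex.I) ∉ U := by
      intro h
      have := hR h
      simp [Complex.norm_exp_ofReal_mul_I, abs_of_pos hR0] at this
    simp only [G, if_neg hn]
    have hRc : (R : ℂ) ≠ 0 := by exact_mod_cast hR0.ne'
    simp [Complex.norm_exp_ofReal_mul_I, abs_of_pos hR0]
    field_simp
  have h3 := h1.unique (fun t h => by have := hG1 (p + R * Complex.exp (t * Complex.I)); simp [h] at this) h2
  linarith

lemma haus_le {f : ℝ → ℂ} {a b : ℝ} (hf : LipschitzOnWith 1 f (Icc a b)) :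
    μH[1] (f '' Icc a b) ≤ ENNReal.ofReal (b - a) := by
  have := hf.hausdorffMeasure_image_le (d := 1) zero_le_one
  simpa [hausdorffMeasure_real] using this

lemma dist_le_haus {f : ℝ → ℂ} {a b : ℝ} (hab : a ≤ b) (hf : ContinuousOn f (Icc a b)) :
    ENNReal.ofReal (dist (f a) (f b)) ≤ μH[1] (f '' Icc a b) := by
  have h1 : LipschitzOnWith 1 (fun z : ℂ => dist (f a) z) (f '' Icc a b) :=
    (LipschitzWith.dist_right (f a)).lipschitzOnWith
  have h2 := h1.hausdorffMeasure_image_le (d := 1) zero_le_one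
  have h3 := intermediate_value_Icc hab
    (f := fun t => dist (f a) (f t)) (by fun_prop)
  have h4 : Icc 0 (dist (f a) (f b)) ⊆ (fun z : ℂ => dist (f a) z) '' (f '' Icc a b) := by
    rw [image_image]
    simpa using h3
  have h5 := measure_mono (μ := volume) h4
  rw [Real.volume_Icc, sub_zero] at h5
  rw [hausdorffMeasure_real] at h2
  simpa using h5.trans h2

lemma length_ge {ℓ : ℝ} {γ : ℝ → ℂ} {C : Set ℂ} (h : NaturalClosedParam ℓ γ C) :
    ENNReal.ofReal ℓ ≤ μH[1] C := by
  obtain ⟨hℓ, hlip, hcl, hinj, rfl, hder⟩ := h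
  have hc := hlip.continuousOn
  have hfinC : μH[1] (γ '' Icc 0 ℓ) ≠ ⊤ :=
    ne_top_of_le_ne_top ENNReal.ofReal_ne_top (haus_le hlip)
  have hfin : ∀ t, t < ℓ → μH[1] (γ '' Icc 0 t) ≠ ⊤ := fun t ht =>
    ne_top_of_le_ne_top hfinC (measure_mono (image_mono (Icc_subset_Icc_right ht.le)))
  let f : ℝ → ℝ := fun t => (μH[1] (γ '' Icc 0 t)).toReal
  have hinc : ∀ s t, 0 ≤ s → s ≤ t → t < ℓ → dist (γ s) (γ t) ≤ f t - f s := by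
    intro s t hs hst ht
    have h1 : γ '' Icc 0 t = γ '' Icc 0 s ∪ γ '' Ioc s t := by
      rw [← image_union, Icc_union_Ioc_eq_Icc hs hst]
    have hd : Disjoint (γ '' Ioc s t) (γ '' Icc 0 s) := by
      rw [Set.disjoint_left]
      rintro _ ⟨u, hu, rfl⟩ ⟨v, hv, huv⟩
      have := hinj ⟨hv.1, hv.2.trans_lt (hst.trans_lt ht)⟩
        ⟨hs.trans hu.1.le, hu.2.trans_lt ht⟩ huv
      linarith [hv.2, hu.1]
    have hm : MeasurableSet (γ '' Icc 0 s) :=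
      (isCompact_Icc.image_of_continuousOn
        (hc.mono (Icc_subset_Icc_right (by linarith)))).isClosed.measurableSet
    have h2 : μH[1] (γ '' Icc 0 t) = μH[1] (γ '' Icc 0 s) + μH[1] (γ '' Ioc s t) := by
      rw [h1, union_comm, measure_union hd hm, add_comm]
    have h3 : ENNReal.ofReal (dist (γ s) (γ t)) ≤ μH[1] (γ '' Ioc s t) := by
      refine (dist_le_haus hst (hc.mono (Icc_subset_Icc hs ht.le))).trans ?_
      have h4 : γ '' Icc s t = {γ s} ∪ γ '' Ioc s t := by
        rw [← Ioc_insert_left hst, image_insert_eq]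
        rfl
      rw [h4]
      have := Measure.nullSingletonClass_hausdorff ℂ (d := 1) one_pos
      refine (measure_union_le _ _).trans ?_
      rw [measure_singleton, zero_add]
    have h5 : μH[1] (γ '' Icc 0 s) + ENNReal.ofReal (dist (γ s) (γ t)) ≤ μH[1] (γ '' Icc 0 t) := by
      rw [h2]
      gcongr
    have h6 := ENNReal.toReal_mono (hfin t ht) h5
    rw [ENNReal.toReal_add (hfin s (by linarith)) ENNReal.ofReal_ne_top,
      ENNReal.toReal_ofReal dist_nonneg] at h6
    simp only [f]
    linarith
  refine le_of_forall_lt fun c hcl' => ?_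
  obtain ⟨b, hb0, hbl⟩ : ∃ b : ℝ, 0 < b ∧ b < ℓ ∧ c < ENNReal.ofReal b := by
    have hcf : c ≠ ⊤ := hcl'.ne_top
    have h1 : c.toReal < ℓ := by
      rw [← ENNReal.ofReal_toReal hcf] at hcl'
      exact (ENNReal.ofReal_lt_ofReal_iff hℓ).1 hcl'
    have h0 : 0 ≤ c.toReal := ENNReal.toReal_nonneg
    refine ⟨(c.toReal + ℓ) / 2, by linarith, by linarith, ?_⟩
    conv_lhs => rw [← ENNReal.ofReal_toReal hcf]
    rw [ENNReal.ofReal_lt_ofReal_iff (by linarith)]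
    linarith
  obtain ⟨hbl, hcb⟩ := hbl
  have hmono : MonotoneOn f (Icc 0 b) := by
    intro s hs t ht hst
    have := hinc s t hs.1 hst (ht.2.trans_lt hbl)
    linarith [dist_nonneg (x := γ s) (y := γ t)]
  have hmono' : MonotoneOn f (uIcc 0 b) := by rwa [uIcc_of_le hb0.le]
  have hae : ∀ᵐ t, t ∈ Ioo 0 b → 1 ≤ deriv f t := by
    have h1 := hmono.ae_differentiableWithinAt_of_mem
    rw [ae_restrict_iff' measurableSet_Ioo] at hder
    filter_upwards [h1, hder] with t ht1 ht2 ht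
    obtain ⟨g, hg, hg1⟩ := ht2 ⟨ht.1, ht.2.trans hbl⟩
    have hfd : HasDerivAt f (deriv f t) t :=
      ((ht1 ⟨ht.1.le, ht.2.le⟩).differentiableAt (Icc_mem_nhds ht.1 ht.2)).hasDerivAt
    have hs1 := (hasDerivAt_iff_tendsto_slope.1 hg).norm
    have hs2 := hasDerivAt_iff_tendsto_slope.1 hfd
    rw [hg1] at hs1
    refine le_of_tendsto_of_tendsto hs1 hs2 ?_
    have hmem : ∀ᶠ u in 𝓝[≠] t, u ∈ Ioo 0 b :=
      nhdsWithin_le_nhds (Ioo_mem_nhds ht.1 ht.2)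
    have key : ∀ s u, 0 ≤ s → s < u → u < ℓ → ‖slope γ s u‖ ≤ slope f s u := by
      intro s u hs hsu hu
      have h3 := hinc s u hs hsu.le hu
      rw [slope_def_field, slope, vsub_eq_sub, norm_smul, norm_inv, Real.norm_eq_abs,
        abs_of_pos (sub_pos.2 hsu), ← dist_eq_norm, dist_comm, div_eq_inv_mul]
      have : 0 < u - s := sub_pos.2 hsu
      gcongr
    filter_upwards [hmem, self_mem_nhdsWithin] with u hu hut
    rcases lt_or_gt_of_ne (show u ≠ t from hut) with h4 | h4
    · rw [slope_comm γ, slope_comm f]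
      exact key u t hu.1.le h4 (ht.2.trans hbl)
    · exact key t u ht.1.le h4 (hu.2.trans hbl)
  have hI := hmono'.intervalIntegral_deriv_mem_uIcc
  have hf0b : f 0 ≤ f b := hmono (left_mem_Icc.2 hb0.le) (right_mem_Icc.2 hb0.le) hb0.le
  rw [uIcc_of_le (by linarith)] at hI
  have hI2 : ∫ x in (0:ℝ)..b, (1:ℝ) ≤ ∫ x in (0:ℝ)..b, deriv f x := by
    refine intervalIntegral.integral_mono_ae_restrict hb0.le (by simp)
      hmono'.intervalIntegrable_deriv ?_
    rw [← restrict_Ioo_eq_restrict_Icc]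
    exact (ae_restrict_iff' measurableSet_Ioo).2 hae
  simp at hI2
  have hfb : b ≤ f b := by
    have : 0 ≤ f 0 := ENNReal.toReal_nonneg
    linarith [hI.2]
  calc c < ENNReal.ofReal b := hcb
    _ ≤ ENNReal.ofReal (f b) := ENNReal.ofReal_le_ofReal hfb
    _ = μH[1] (γ '' Icc 0 b) := ENNReal.ofReal_toReal (hfin b hbl)
    _ ≤ _ := measure_mono (image_mono (Icc_subset_Icc_right hbl.le))

lemma length_eq {ℓ : ℝ} {γ : ℝ → ℂ} {C : Set ℂ} (h : NaturalClosedParam ℓ γ C) :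
    μH[1] C = ENNReal.ofReal ℓ := by
  refine le_antisymm ?_ (length_ge h)
  obtain ⟨hℓ, hlip, hcl, hinj, rfl, hder⟩ := h
  simpa using haus_le hlip

lemma coe_circle_iff {ℓ x y : ℝ} : (x : AddCircle ℓ) = (y : AddCircle ℓ) ↔
    ∃ k : ℤ, x - y = k * ℓ := by
  rw [← sub_eq_zero, ← AddCircle.coe_sub, AddCircle.coe_eq_zero_iff]
  simp [eq_comm]

/-- Periodic extension of `γ`. -/
def pext (ℓ : ℝ) [Fact (0 < ℓ)] (γ : ℝ → ℂ) (x : ℝ) : ℂ :=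
  AddCircle.liftIco ℓ 0 γ (x : AddCircle ℓ)

section pext
variable {ℓ : ℝ} [hℓ : Fact (0 < ℓ)] {γ : ℝ → ℂ}

lemma pext_eq (hcl : γ 0 = γ ℓ) {x : ℝ} (hx : x ∈ Icc 0 ℓ) : pext ℓ γ x = γ x := by
  rcases hx.2.lt_or_eq with h | h
  · exact AddCircle.liftIco_zero_coe_apply ⟨hx.1, h⟩
  · subst h
    rw [pext, AddCircle.coe_period, ← hcl]
    exact AddCircle.liftIco_zero_coe_apply (x := (0 : ℝ)) ⟨le_rfl, hℓ.out⟩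

lemma pext_add (x : ℝ) (k : ℤ) : pext ℓ γ (x + k * ℓ) = pext ℓ γ x := by
  unfold pext
  congr 1
  exact coe_circle_iff.2 ⟨k, by ring⟩

lemma liftIco_inj (hinj : InjOn γ (Ico 0 ℓ)) :
    Function.Injective (AddCircle.liftIco ℓ 0 γ) := by
  intro x y h
  apply (AddCircle.equivIco ℓ 0).injective
  have hx : ((AddCircle.equivIco ℓ 0 x : ℝ)) ∈ Ico 0 ℓ := by
    simpa only [zero_add] using (AddCircle.equivIco ℓ 0 x).2
  have hy : ((AddCircle.equivIco ℓ 0 y : ℝ)) ∈ Ico 0 ℓ := by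
    simpa only [zero_add] using (AddCircle.equivIco ℓ 0 y).2
  exact Subtype.ext (hinj hx hy h)

lemma pext_inj (hinj : InjOn γ (Ico 0 ℓ)) {x y : ℝ}
    (h : pext ℓ γ x = pext ℓ γ y) : ∃ k : ℤ, x - y = k * ℓ :=
  coe_circle_iff.1 (liftIco_inj hinj h)

lemma exists_shift (x a : ℝ) : ∃ k : ℤ, x + k * ℓ ∈ Ico a (a + ℓ) := by
  obtain ⟨k, hk, -⟩ := existsUnique_add_zsmul_mem_Ico hℓ.out x a
  exact ⟨k, by simpa using hk⟩

lemma liftIco_mem (x : AddCircle ℓ) : AddCircle.liftIco ℓ 0 γ x ∈ γ '' Icc 0 ℓ := by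
  have hx : ((AddCircle.equivIco ℓ 0 x : ℝ)) ∈ Ico 0 ℓ := by
    simpa only [zero_add] using (AddCircle.equivIco ℓ 0 x).2
  exact ⟨_, Ico_subset_Icc_self hx, rfl⟩

lemma pext_lip (hcl : γ 0 = γ ℓ) (hlip : LipschitzOnWith 1 γ (Icc 0 ℓ)) :
    LipschitzWith 1 (pext ℓ γ) := by
  have h0 := hℓ.out
  have cell : ∀ (n : ℤ) (x y : ℝ), n * ℓ ≤ x → x ≤ y → y ≤ (n + 1) * ℓ →
      dist (pext ℓ γ x) (pext ℓ γ y) ≤ y - x := by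
    intro n x y h1 h2 h3
    have hx : x + ((-n : ℤ) : ℝ) * ℓ ∈ Icc 0 ℓ := by
      push_cast
      constructor <;> linarith
    have hy : y + ((-n : ℤ) : ℝ) * ℓ ∈ Icc 0 ℓ := by
      push_cast
      constructor <;> linarith
    rw [← pext_add x (-n), ← pext_add y (-n), pext_eq hcl hx, pext_eq hcl hy]
    have := hlip.dist_le_mul _ hx _ hy
    rw [dist_comm (x + _), Real.dist_eq, abs_of_nonneg (by linarith)] at this
    simp only [NNReal.coe_one, one_mul] at this
    linarith
  have main : ∀ x y : ℝ, x ≤ y → dist (pext ℓ γ x) (pext ℓ γ y) ≤ y - x := by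
    intro x y hxy
    obtain ⟨n, hn⟩ := exists_shift (ℓ := ℓ) x 0
    obtain ⟨m, hm⟩ := exists_shift (ℓ := ℓ) y 0
    have hx1 : ((-n : ℤ) : ℝ) * ℓ ≤ x := by push_cast; linarith [hn.1]
    have hx2 : x ≤ (((-n : ℤ) : ℝ) + 1) * ℓ := by push_cast; linarith [hn.2]
    have hy1 : ((-m : ℤ) : ℝ) * ℓ ≤ y := by push_cast; linarith [hm.1]
    have hy2 : y ≤ (((-m : ℤ) : ℝ) + 1) * ℓ := by push_cast; linarith [hm.2]
    by_cases hc : y ≤ (((-n : ℤ) : ℝ) + 1) * ℓ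
    · exact cell _ x y hx1 hxy hc
    · push Not at hc
      have hnm : -n + 1 ≤ -m := by
        have h5 : (((-n : ℤ) : ℝ) + 1) * ℓ < (((-m : ℤ) : ℝ) + 1) * ℓ := hc.trans_le hy2
        have h6 := lt_of_mul_lt_mul_right h5 h0.le
        have h7 : (-n : ℤ) + 1 < -m + 1 := by exact_mod_cast h6
        omega
      have hnm' : (((-n : ℤ) : ℝ) + 1) * ℓ ≤ ((-m : ℤ) : ℝ) * ℓ := by
        have : (((-n : ℤ) : ℝ) + 1) ≤ ((-m : ℤ) : ℝ) := by exact_mod_cast hnm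
        gcongr
      have d1 := cell (-n) x _ hx1 hx2 le_rfl
      have d2 := cell (-m) _ y le_rfl hy1 hy2
      have e1 : pext ℓ γ ((((-n : ℤ) : ℝ) + 1) * ℓ) = pext ℓ γ 0 := by
        rw [← pext_add 0 (-n + 1)]
        congr 1
        push_cast
        ring
      have e2 : pext ℓ γ (((-m : ℤ) : ℝ) * ℓ) = pext ℓ γ 0 := by
        rw [← pext_add 0 (-m)]
        congr 1
        push_cast
        ring
      rw [e1] at d1
      rw [e2] at d2
      have := dist_triangle (pext ℓ γ x) (pext ℓ γ 0) (pext ℓ γ y)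
      linarith
  refine LipschitzWith.of_dist_le_mul fun x y => ?_
  simp only [NNReal.coe_one, one_mul, Real.dist_eq]
  rcases le_total x y with h | h
  · rw [abs_sub_comm, abs_of_nonneg (by linarith)]
    exact main x y h
  · rw [abs_of_nonneg (by linarith), dist_comm]
    exact main y x h

lemma pext_length {C : Set ℂ} (h : NaturalClosedParam ℓ γ C) {a b : ℝ} (hab : a ≤ b)
    (hb : b ≤ a + ℓ) : ENNReal.ofReal (b - a) ≤ μH[1] (pext ℓ γ '' Icc a b) := by
  have hl := length_ge h
  obtain ⟨-, hlip, hcl, hinj, rfl, hder⟩ := h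
  have hL := pext_lip hcl hlip
  have hsub : γ '' Icc 0 ℓ ⊆ pext ℓ γ '' Icc a b ∪ pext ℓ γ '' Icc b (a + ℓ) := by
    rw [← image_union, Icc_union_Icc_eq_Icc hab hb]
    rintro _ ⟨t, ht, rfl⟩
    obtain ⟨k, hk⟩ := exists_shift (ℓ := ℓ) t a
    exact ⟨_, Ico_subset_Icc_self hk, by rw [pext_add, pext_eq hcl ht]⟩
  have h1 : ENNReal.ofReal (b - a) + ENNReal.ofReal (a + ℓ - b) ≤
      μH[1] (pext ℓ γ '' Icc a b) + ENNReal.ofReal (a + ℓ - b) := by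
    rw [← ENNReal.ofReal_add (by linarith) (by linarith)]
    have e : b - a + (a + ℓ - b) = ℓ := by ring
    rw [e]
    refine hl.trans ((measure_mono hsub).trans ((measure_union_le _ _).trans ?_))
    gcongr
    exact haus_le hL.lipschitzOnWith
  exact (ENNReal.add_le_add_iff_right ENNReal.ofReal_ne_top).1 h1

lemma exists_lift (hcl : γ 0 = γ ℓ) (hc : ContinuousOn γ (Icc 0 ℓ)) (hinj : InjOn γ (Ico 0 ℓ))
    {σ : ℝ → ℂ} (hσ : Continuous σ) (hσC : ∀ t ∈ Icc 0 ℓ, σ t ∈ γ '' Icc 0 ℓ) (h0 : σ 0 = γ 0) :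
    ∃ S : ℝ → ℝ, Continuous S ∧ S 0 = 0 ∧ ∀ t ∈ Icc 0 ℓ, pext ℓ γ (S t) = σ t := by
  have hl := hℓ.out
  let e0 : AddCircle ℓ → γ '' Icc 0 ℓ := fun x => ⟨AddCircle.liftIco ℓ 0 γ x, liftIco_mem x⟩
  have he0c : Continuous e0 := (AddCircle.liftIco_zero_continuous hcl hc).subtype_mk _
  have he0b : Function.Bijective e0 := by
    constructor
    · intro x y hxy
      exact liftIco_inj hinj (congrArg Subtype.val hxy)
    · rintro ⟨z, t, ht, rfl⟩
      exact ⟨(t : AddCircle ℓ), Subtype.ext (pext_eq hcl ht)⟩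
  let e : AddCircle ℓ ≃ₜ γ '' Icc 0 ℓ :=
    Continuous.homeoOfEquivCompactToT2 (f := Equiv.ofBijective e0 he0b) he0c
  have he : ∀ x, (e x : ℂ) = AddCircle.liftIco ℓ 0 γ x := fun x => rfl
  have hmem : ∀ s : unitInterval, ℓ * (s : ℝ) ∈ Icc 0 ℓ := fun s =>
    ⟨mul_nonneg hl.le s.2.1, mul_le_of_le_one_right hl.le s.2.2⟩
  let c : C(unitInterval, AddCircle ℓ) :=
    ⟨fun s => e.symm ⟨σ (ℓ * s), hσC _ (hmem s)⟩, by
      refine e.symm.continuous.comp (Continuous.subtype_mk ?_ _)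
      fun_prop⟩
  have hc0 : c 0 = ((0 : ℝ) : AddCircle ℓ) := by
    change e.symm _ = _
    rw [e.symm_apply_eq]
    apply Subtype.ext
    rw [he]
    have := pext_eq (ℓ := ℓ) hcl (x := 0) ⟨le_rfl, hl.le⟩
    rw [pext] at this
    rw [this]
    simp [h0]
  obtain ⟨L, hL, hL0⟩ := (AddCircle.isCoveringMap_coe ℓ).exists_path_lifts c (0 : ℝ) hc0
  refine ⟨fun t => L (projIcc 0 1 zero_le_one (t / ℓ)), by fun_prop, ?_, ?_⟩
  · simp only [zero_div]
    rw [projIcc_left]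
    exact hL0
  · intro t ht
    have ht' : t / ℓ ∈ Icc (0 : ℝ) 1 := ⟨div_nonneg ht.1 hl.le, (div_le_one hl).2 ht.2⟩
    simp only [projIcc_of_mem zero_le_one ht']
    have h1 := congrFun hL ⟨t / ℓ, ht'⟩
    simp only [Function.comp] at h1
    rw [pext]
    change AddCircle.liftIco ℓ 0 γ (QuotientAddGroup.mk _) = _
    rw [h1, ← he]
    simp only [c, ContinuousMap.coe_mk, Homeomorph.apply_symm_apply]
    congr 1
    field_simp

lemma rigid {C : Set ℂ} (h : NaturalClosedParam ℓ γ C) {σ : ℝ → ℂ} (hσ : LipschitzWith 1 σ)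
    (hσC : σ '' Icc 0 ℓ = C) (h0 : σ 0 = γ 0) :
    (∀ t ∈ Icc 0 ℓ, σ t = γ t) ∨ (∀ t ∈ Icc 0 ℓ, σ t = γ (ℓ - t)) := by
  have hlen := fun a b hab hb => pext_length h (a := a) (b := b) hab hb
  obtain ⟨hl, hlip, hcl, hinj, rfl, hder⟩ := h
  obtain ⟨S, hS, hS0, hSσ⟩ := exists_lift hcl hlip.continuousOn hinj hσ.continuous
    (fun t ht => hσC ▸ mem_image_of_mem σ ht) h0
  have hS1 : ∀ s t, 0 ≤ s → s ≤ t → t ≤ ℓ → |S t - S s| ≤ ℓ → |S t - S s| ≤ t - s := by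
    intro s t hs hst ht hle
    have h1 : uIcc (S s) (S t) ⊆ S '' Icc s t := by
      have := intermediate_value_uIcc (f := S) (a := s) (b := t) hS.continuousOn
      rwa [uIcc_of_le hst] at this
    have h2 : pext ℓ γ '' uIcc (S s) (S t) ⊆ σ '' Icc s t := by
      rintro _ ⟨x, hx, rfl⟩
      obtain ⟨u, hu, rfl⟩ := h1 hx
      exact ⟨u, hu, (hSσ u ⟨hs.trans hu.1, hu.2.trans ht⟩).symm⟩
    have h3 := hlen (S s ⊓ S t) (S s ⊔ S t) inf_le_sup (by
      have := sup_sub_inf_eq_abs_sub (S s) (S t)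
      linarith)
    rw [sup_sub_inf_eq_abs_sub] at h3
    have h4 := (h3.trans (measure_mono h2)).trans (haus_le hσ.lipschitzOnWith)
    exact (ENNReal.ofReal_le_ofReal_iff (by linarith)).1 h4
  have hS2 : ∀ s t, 0 ≤ s → s ≤ t → t ≤ ℓ → |S t - S s| ≤ t - s := by
    intro s t hs hst ht
    by_cases hle : |S t - S s| ≤ ℓ
    · exact hS1 s t hs hst ht hle
    · exfalso
      push Not at hle
      obtain ⟨u, hu, hu'⟩ := intermediate_value_Icc (f := fun u => |S u - S s|) hst
        (by fun_prop) (show ℓ ∈ _ from ⟨by simpa using hl.le, hle.le⟩)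
      simp only at hu'
      have h1 := hS1 s u hs hu.1 (hu.2.trans ht) hu'.le
      rw [hu'] at h1
      have : u = t := by linarith [hu.2]
      rw [this] at hu'
      linarith
  obtain ⟨s0, hs0, hmin⟩ := isCompact_Icc.exists_isMinOn (nonempty_Icc.2 hl.le)
    (hS.continuousOn (s := Icc 0 ℓ))
  obtain ⟨s1, hs1, hmax⟩ := isCompact_Icc.exists_isMaxOn (nonempty_Icc.2 hl.le)
    (hS.continuousOn (s := Icc 0 ℓ))
  have hMm : ℓ ≤ S s1 - S s0 := by
    by_contra hlt
    push Not at hlt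
    have h1 : pext ℓ γ ((S s1 + S s0 + ℓ) / 2) ∈ σ '' Icc 0 ℓ := by
      rw [hσC]
      exact liftIco_mem _
    obtain ⟨t, ht, h2⟩ := h1
    rw [← hSσ t ht] at h2
    obtain ⟨k, hk⟩ := pext_inj hinj h2.symm
    have h3 : S s0 ≤ S t := hmin ht
    have h4 : S t ≤ S s1 := hmax ht
    have h5 : (0 : ℝ) * ℓ < k * ℓ := by linarith
    have h6 : (k : ℝ) * ℓ < 1 * ℓ := by linarith
    have h7 := lt_of_mul_lt_mul_right h5 hl.le
    have h8 := lt_of_mul_lt_mul_right h6 hl.le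
    have h9 : (0 : ℤ) < k := by exact_mod_cast h7
    have h10 : k < (1 : ℤ) := by exact_mod_cast h8
    omega
  rcases le_total s0 s1 with hle | hle
  · left
    have h1 := hS2 s0 s1 hs0.1 hle hs1.2
    have h2 := le_abs_self (S s1 - S s0)
    have e0 : s0 = 0 := by linarith [hs0.1, hs1.2]
    have e1 : s1 = ℓ := by linarith [hs0.1, hs1.2]
    rw [e0, e1, hS0] at hMm
    intro t ht
    have h3 := hS2 0 t le_rfl ht.1 ht.2
    have h4 := hS2 t ℓ ht.1 ht.2 le_rfl
    rw [abs_le] at h3 h4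
    have : S t = t := by linarith [h3.2, h4.2]
    rw [← hSσ t ht, this, pext_eq hcl ht]
  · right
    have h1 := hS2 s1 s0 hs1.1 hle hs0.2
    have h2 := neg_abs_le (S s0 - S s1)
    have e0 : s1 = 0 := by linarith [hs1.1, hs0.2]
    have e1 : s0 = ℓ := by linarith [hs1.1, hs0.2]
    rw [e0, e1, hS0] at hMm
    intro t ht
    have h3 := hS2 0 t le_rfl ht.1 ht.2
    have h4 := hS2 t ℓ ht.1 ht.2 le_rfl
    rw [abs_le] at h3 h4
    have : S t = -t := by linarith [h3.1, h4.1]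
    rw [← hSσ t ht, this, ← pext_add (-t) 1]
    rw [← pext_eq hcl (x := ℓ - t) ⟨by linarith [ht.2], by linarith [ht.1]⟩]
    congr 1
    push_cast
    ring

end pext

lemma cext_lip {ℓ : ℝ} (hℓ : 0 < ℓ) {γ : ℝ → ℂ} (h : LipschitzOnWith 1 γ (Icc 0 ℓ)) (s t : ℝ) :
    dist (cext ℓ γ s) (cext ℓ γ t) ≤ |s - t| := by
  have h1 := h.dist_le_mul _ (clamp_mem hℓ s) _ (clamp_mem hℓ t)
  have h2 : LipschitzWith 1 (fun t : ℝ => max 0 (min ℓ t)) :=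
    (LipschitzWith.id.const_min ℓ).const_max 0
  have h3 := h2.dist_le_mul s t
  simp only [NNReal.coe_one, one_mul] at h1 h3
  rw [Real.dist_eq s t] at h3
  exact h1.trans h3

/-- Limits along ultrafilters exist for eventually bounded sequences. -/
lemma ultra_lim {X : Type*} [TopologicalSpace X] {K : Set X} (hK : IsCompact K)
    (U : Ultrafilter ℕ) {x : ℕ → X} (hx : ∀ᶠ n in (U : Filter ℕ), x n ∈ K) :
    ∃ a ∈ K, Tendsto x U (𝓝 a) := by
  obtain ⟨a, ha, h⟩ := hK.ultrafilter_le_nhds (U.map x) (by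
    rw [le_principal_iff]
    exact hx)
  exact ⟨a, ha, h⟩

/-- **Rigidity of convergence of closed curves.**
If `C_n → C` in the Hausdorff metric with `H¹(C_n) → H¹(C)` and `γ_n(0) → γ(0)` for
positively oriented natural parametrizations `γ_n`, `γ` of the closed simple Lipschitz
curves `C_n`, `C`, then the arcs `γ_n([0,τ])` converge to `γ([0,τ])` in the Hausdorff
metric for every `τ ∈ (0,ℓ)`. -/
theorem rigidity_of_natural_parametrizations
    (ℓseq : ℕ → ℝ) (γseq : ℕ → ℝ → ℂ) (Cseq : ℕ → Set ℂ)
    (ℓ : ℝ) (γ : ℝ → ℂ) (C : Set ℂ)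
    (hn : ∀ n, NaturalClosedParam (ℓseq n) (γseq n) (Cseq n))
    (hon : ∀ n, PositivelyOriented (ℓseq n) (γseq n) (Cseq n))
    (h : NaturalClosedParam ℓ γ C) (ho : PositivelyOriented ℓ γ C)
    (hH : Tendsto (fun n => Metric.hausdorffDist (Cseq n) C) atTop (𝓝 0))
    (hlen : Tendsto (fun n => μH[1] (Cseq n)) atTop (𝓝 (μH[1] C)))
    (h0 : Tendsto (fun n => γseq n 0) atTop (𝓝 (γ 0))) :
    ∀ τ ∈ Set.Ioo 0 ℓ,
      Tendsto (fun n => Metric.hausdorffDist (γseq n '' Set.Icc 0 τ) (γ '' Set.Icc 0 τ))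
        atTop (𝓝 0) := by
  intro τ hτ
  have hℓ := h.1
  haveI : Fact (0 < ℓ) := ⟨hℓ⟩
  have hℓlim : Tendsto ℓseq atTop (𝓝 ℓ) := by
    have h1 : Tendsto (fun n => (μH[1] (Cseq n)).toReal) atTop (𝓝 (μH[1] C).toReal) :=
      (ENNReal.tendsto_toReal (by rw [length_eq h]; exact ENNReal.ofReal_ne_top)).comp hlen
    simp only [length_eq h, fun n => length_eq (hn n), ENNReal.toReal_ofReal hℓ.le,
      fun n => ENNReal.toReal_ofReal (hn n).1.le] at h1
    exact h1
  rw [tendsto_iff_ultrafilter]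
  intro U hU
  let g : ℕ → ℝ → ℂ := fun n => cext (ℓseq n) (γseq n)
  have hglip : ∀ n s t, dist (g n s) (g n t) ≤ |s - t| := fun n => cext_lip (hn n).1 (hn n).2.1
  have hg0 : ∀ n, g n 0 = γseq n 0 := fun n => cext_of_le _ le_rfl
  have hgC : ∀ n t, g n t ∈ Cseq n := fun n t => by
    rw [(hn n).2.2.2.2.1]; exact cext_mem (hn n).1 _ t
  have hge : ∀ n t, ℓseq n ≤ t → g n t = γseq n 0 := fun n t ht => by
    rw [(hn n).2.2.1]; exact cext_of_ge (hn n).1 _ ht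
  replace hℓlim := hℓlim.mono_left hU
  replace h0 := h0.mono_left hU
  replace hH := hH.mono_left hU
  have hCc : ∀ {ℓ γ C}, NaturalClosedParam ℓ γ C → IsCompact C ∧ C.Nonempty := by
    rintro ℓ γ C ⟨hl, hlip, -, -, rfl, -⟩
    exact ⟨isCompact_Icc.image_of_continuousOn hlip.continuousOn,
      (nonempty_Icc.2 hl.le).image _⟩
  have hfin : ∀ n, Metric.hausdorffEDist (Cseq n) C ≠ ⊤ := fun n =>
    Metric.hausdorffEDist_ne_top_of_nonempty_of_bounded (hCc (hn n)).2 (hCc h).2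
      (hCc (hn n)).1.isBounded (hCc h).1.isBounded
  have hlt1 : ∀ᶠ n in (U : Filter ℕ), ℓseq n < ℓ + 1 :=
    hℓlim.eventually (gt_mem_nhds (by linarith))
  -- the pointwise limit
  have hex : ∀ t, ∃ a, Tendsto (fun n => g n t) U (𝓝 a) := by
    intro t
    obtain ⟨a, -, ha⟩ := ultra_lim (isCompact_closedBall (γ 0) (|t| + 1)) U
      (x := fun n => g n t) (by
        filter_upwards [Metric.tendsto_nhds.1 h0 1 one_pos] with n hn1
        have h1 := hglip n t 0
        rw [hg0, sub_zero] at h1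
        rw [Metric.mem_closedBall]
        linarith [dist_triangle (g n t) (γseq n 0) (γ 0)])
    exact ⟨a, ha⟩
  choose σ hσ using hex
  have hσd : ∀ s t, dist (σ s) (σ t) ≤ |s - t| := fun s t =>
    le_of_tendsto ((hσ s).dist (hσ t)) (Eventually.of_forall fun n => hglip n s t)
  have hσlip : LipschitzWith 1 σ := LipschitzWith.of_dist_le_mul fun s t => by
    simpa [Real.dist_eq] using hσd s t
  have hσ0 : σ 0 = γ 0 := by
    have := hσ 0
    simp only [hg0] at this
    exact tendsto_nhds_unique this h0
  have hσge : ∀ t, ℓ < t → σ t = γ 0 := by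
    intro t ht
    refine tendsto_nhds_unique (hσ t) (h0.congr' ?_)
    filter_upwards [hℓlim.eventually (gt_mem_nhds ht)] with n hnt
    exact (hge n t hnt.le).symm
  have hseq : ∀ (u : ℕ → ℝ) (t : ℝ), Tendsto u U (𝓝 t) →
      Tendsto (fun n => g n (u n)) U (𝓝 (σ t)) := by
    intro u t hu
    rw [tendsto_iff_dist_tendsto_zero]
    have h1 : Tendsto (fun n => |u n - t| + dist (g n t) (σ t)) U (𝓝 (0 + 0)) := by
      refine Tendsto.add ?_ (tendsto_iff_dist_tendsto_zero.1 (hσ t))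
      simpa [Real.dist_eq] using tendsto_iff_dist_tendsto_zero.1 hu
    rw [add_zero] at h1
    refine squeeze_zero (fun n => dist_nonneg) (fun n => ?_) h1
    exact (dist_triangle _ (g n t) _).trans (by gcongr; exact hglip n _ _)
  have hunif : ∀ ε > 0, ∀ᶠ n in (U : Filter ℕ), ∀ t ∈ Icc 0 (ℓ + 1), dist (g n t) (σ t) < ε := by
    intro ε hε
    by_contra hcon
    rw [← Ultrafilter.eventually_not] at hcon
    have h1 : ∀ n, ∃ t ∈ Icc 0 (ℓ + 1), (¬ ∀ t ∈ Icc 0 (ℓ + 1), dist (g n t) (σ t) < ε) →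
        ε ≤ dist (g n t) (σ t) := by
      intro n
      by_cases hb : ∀ t ∈ Icc 0 (ℓ + 1), dist (g n t) (σ t) < ε
      · exact ⟨0, ⟨le_rfl, by linarith⟩, fun h' => absurd hb h'⟩
      · have hb' := hb
        push Not at hb'
        obtain ⟨t, ht, h2⟩ := hb'
        exact ⟨t, ht, fun _ => h2⟩
    choose u hu hub using h1
    obtain ⟨t, -, ht⟩ := ultra_lim isCompact_Icc U (x := u) (Eventually.of_forall hu)
    have h2 := (hseq u t ht).dist ((hσlip.continuous.tendsto t).comp ht)
    rw [dist_self] at h2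
    have h3 := h2.eventually (gt_mem_nhds hε)
    obtain ⟨n, hn1, hn2⟩ := (h3.and hcon).exists
    exact absurd (hub n hn2) (not_le.2 hn1)
  have himg : σ '' Icc 0 ℓ = C := by
    apply Subset.antisymm
    · rintro _ ⟨t, -, rfl⟩
      rw [(hCc h).1.isClosed.mem_iff_infDist_zero (hCc h).2]
      have h1 : Tendsto (fun n => Metric.infDist (g n t) C) U (𝓝 (Metric.infDist (σ t) C)) :=
        ((Metric.continuous_infDist_pt C).tendsto _).comp (hσ t)
      have h2 : Tendsto (fun n => Metric.infDist (g n t) C) U (𝓝 0) :=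
        squeeze_zero (fun n => Metric.infDist_nonneg)
          (fun n => Metric.infDist_le_hausdorffDist_of_mem (hgC n t) (hfin n)) hH
      exact tendsto_nhds_unique h1 h2
    · intro c hc
      have h1 : ∀ n, ∃ t ∈ Icc 0 (ℓseq n), dist (g n t) c ≤ Metric.hausdorffDist (Cseq n) C := by
        intro n
        obtain ⟨y, hy, hyd⟩ := (hCc (hn n)).1.exists_infDist_eq_dist (hCc (hn n)).2 c
        have h2 := Metric.infDist_le_hausdorffDist_of_mem hc (t := Cseq n)
          (by rw [Metric.hausdorffEDist_comm]; exact hfin n)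
        rw [Metric.hausdorffDist_comm, hyd, dist_comm] at h2
        rw [(hn n).2.2.2.2.1] at hy
        obtain ⟨t, ht, rfl⟩ := hy
        refine ⟨t, ht, ?_⟩
        have : g n t = γseq n t := cext_eq _ ht
        rw [this]
        exact h2
      choose u hu hud using h1
      obtain ⟨t, ht, htl⟩ := ultra_lim (isCompact_Icc (a := (0 : ℝ)) (b := ℓ + 1)) U (x := u) (by
        filter_upwards [hlt1] with n h2
        exact ⟨(hu n).1, (hu n).2.trans h2.le⟩)
      refine ⟨t, ⟨ht.1, le_of_tendsto_of_tendsto htl hℓlim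
        (Eventually.of_forall fun n => (hu n).2)⟩, ?_⟩
      refine tendsto_nhds_unique (hseq u t htl) ?_
      rw [tendsto_iff_dist_tendsto_zero]
      exact squeeze_zero (fun n => dist_nonneg) hud hH
  rcases rigid h hσlip himg hσ0 with hgood | hbad
  · rw [Metric.tendsto_nhds]
    intro ε hε
    filter_upwards [hunif (ε / 2) (half_pos hε), hℓlim.eventually (lt_mem_nhds hτ.2)]
      with n h1 h2
    have h3 : ∀ t ∈ Icc 0 τ, dist (γseq n t) (γ t) ≤ ε / 2 := by
      intro t ht
      have h4 := h1 t ⟨ht.1, by linarith [ht.2, hτ.2]⟩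
      have h5 : g n t = γseq n t := cext_eq _ ⟨ht.1, by linarith [ht.2]⟩
      rw [h5, hgood t ⟨ht.1, by linarith [ht.2, hτ.2]⟩] at h4
      exact h4.le
    have h6 : Metric.hausdorffDist (γseq n '' Icc 0 τ) (γ '' Icc 0 τ) ≤ ε / 2 := by
      refine Metric.hausdorffDist_le_of_mem_dist (half_pos hε).le ?_ ?_
      · rintro _ ⟨t, ht, rfl⟩
        exact ⟨_, ⟨t, ht, rfl⟩, h3 t ht⟩
      · rintro _ ⟨t, ht, rfl⟩
        exact ⟨_, ⟨t, ht, rfl⟩, by rw [dist_comm]; exact h3 t ht⟩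
    rw [Real.dist_eq, sub_zero, abs_of_nonneg Metric.hausdorffDist_nonneg]
    linarith
  · exfalso
    obtain ⟨-, hlip, hcl, hinj, hCeq, -⟩ := id h
    obtain ⟨p, hpC, -, θ, hθ, he, hi⟩ := ho
    let ρ : ℝ → ℂ := cext ℓ (fun t => γ (ℓ - t))
    have hrev : MapsTo (fun t : ℝ => ℓ - t) (Icc 0 ℓ) (Icc 0 ℓ) := fun t ht =>
      ⟨by linarith [ht.2], by linarith [ht.1]⟩
    have hρc : Continuous ρ :=
      cext_continuous hℓ (hlip.continuousOn.comp (by fun_prop) hrev)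
    have hρC : ∀ t, ρ t ∈ C := by
      intro t
      rw [hCeq]
      exact ⟨_, hrev (clamp_mem hℓ t), rfl⟩
    have hρσ : ∀ t ∈ Icc 0 (ℓ + 1), σ t = ρ t := by
      intro t ht
      rcases le_or_gt t ℓ with h1 | h1
      · rw [hbad t ⟨ht.1, h1⟩]
        exact (cext_eq (fun t => γ (ℓ - t)) ⟨ht.1, h1⟩).symm
      · rw [hσge t h1]
        have : ρ t = γ (ℓ - ℓ) := cext_of_ge hℓ _ h1.le
        rw [this, sub_self]
    have hρw : Wind (fun t => ρ t - p) (ℓ + 1) (-(2 * Real.pi)) := by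
      refine Wind.of_on hℓ (by linarith) (θ := fun t => θ (ℓ - t))
        (hθ.comp (by fun_prop) hrev) (fun t ht => he _ (hrev ht)) ?_
      simp only [sub_self, sub_zero]
      linarith
    have hd : 0 < Metric.infDist p C := ((hCc h).1.isClosed.notMem_iff_infDist_pos (hCc h).2).1 hpC
    obtain ⟨n, h1, h2⟩ := ((hunif _ hd).and hlt1).exists
    have hall : ∀ t, dist (g n t) (ρ t) < Metric.infDist p C := by
      have hin : ∀ t ∈ Icc 0 (ℓ + 1), dist (g n t) (ρ t) < Metric.infDist p C := fun t ht => by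
        rw [← hρσ t ht]; exact h1 t ht
      intro t
      rcases le_or_gt t 0 with h3 | h3
      · have e1 : g n t = g n 0 := by rw [hg0]; exact cext_of_le _ h3
        have e2 : ρ t = ρ 0 := by
          have a1 : ρ t = γ (ℓ - 0) := cext_of_le _ h3
          have a2 : ρ 0 = γ (ℓ - 0) := cext_of_le _ le_rfl
          rw [a1, a2]
        rw [e1, e2]
        exact hin 0 ⟨le_rfl, by linarith⟩
      · rcases le_or_gt t (ℓ + 1) with h4 | h4
        · exact hin t ⟨h3.le, h4⟩
        · have e1 : g n t = g n (ℓ + 1) := by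
            rw [hge n _ h2.le, hge n _ (h2.le.trans h4.le)]
          have e2 : ρ t = ρ (ℓ + 1) := by
            have a1 : ρ t = γ (ℓ - ℓ) := cext_of_ge hℓ _ (by linarith)
            have a2 : ρ (ℓ + 1) = γ (ℓ - ℓ) := cext_of_ge hℓ _ (by linarith)
            rw [a1, a2]
          rw [e1, e2]
          exact hin _ ⟨by linarith, le_rfl⟩
    have hlt : ∀ t, ‖(g n t - p) - (ρ t - p)‖ < ‖ρ t - p‖ := by
      intro t
      rw [sub_sub_sub_cancel_right, ← dist_eq_norm, ← dist_eq_norm, dist_comm (ρ t) p]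
      exact (hall t).trans_le (Metric.infDist_le_dist_of_mem (hρC t))
    have hne : ∀ t, g n t - p ≠ 0 := by
      intro t h3
      have := hlt t
      rw [h3, zero_sub, norm_neg] at this
      exact lt_irrefl _ this
    obtain ⟨hln, hlipn, hcln, hinjn, hCn, -⟩ := hn n
    have hgc : Continuous (g n) := cext_continuous hln hlipn.continuousOn
    have hw1 : Wind (fun t => g n t - p) (ℓ + 1) (-(2 * Real.pi)) := by
      refine hρw.perturb (by fun_prop) (by fun_prop) hlt ?_ ?_
      · have e1 : ρ 0 = γ (ℓ - 0) := cext_of_le _ le_rfl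
        have e2 : ρ (ℓ + 1) = γ (ℓ - ℓ) := cext_of_ge hℓ _ (by linarith)
        simp only [e1, e2, sub_zero, sub_self, hcl]
      · simp only [hg0, hge n _ h2.le]
    have hw2 : Wind (fun t => g n t - p) (ℓseq n) (-(2 * Real.pi)) := by
      refine hw1.shrink (fun t ht => ?_) h2.le (hne _)
      simp only [hge n _ ht, hge n _ le_rfl]
    obtain ⟨q, hqC, hqb, θ', hθ', he', hi'⟩ := hon n
    rw [hCn] at hqC hqb
    refine not_both hln hlipn.continuousOn hcln hinjn hqC ?_ hqb
      (Wind.of_on hln le_rfl hθ' he' hi') hw2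
    rintro ⟨t, ht, rfl⟩
    exact hne t (by rw [show g n t = γseq n t from cext_eq _ ht, sub_self])
end
end

section
/- Let Ω ⊂ ℝ² be open and x ∈ Ω. Let f ∈ L¹(Ω) admit a weak gradient g ∈ L¹(Ω; ℝ²), i.e. ∫_Ω f ∂_i φ dy = −∫_Ω g_i φ dy for every φ ∈ C_c^∞(Ω) and i = 1,2. Suppose f ∈ t^{1,1}(x), i.e. there is a polynomial p of degree ≤ 1 with (1/r²)∫_{B_r(x)} |f(y) − p(y)| dy = o(r) as r → 0, and suppose g ∈ t^{1,1}(x), i.e. there is an ℝ²-valued map P with polynomial components of degree ≤ 1 such that (1/r²)∫_{B_r(x)} |g(y) − P(y)| dy = o(r) as r → 0. Then f ∈ t^{2,1}(x): there is a polynomial q of degree ≤ 2 with (1/r²)∫_{B_r(x)} |f(y) − q(y)| dy = o(r²) as r → 0, and moreover ∇q(y) = P(y) for every y ∈ ℝ². -/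
open MeasureTheory Set Filter
open scoped Topology ENNReal RealInnerProductSpace

noncomputable section

abbrev E2 : Type := EuclideanSpace ℝ (Fin 2)

/-- `L¹` duality with smooth test functions. -/
lemma dual_bound (u : E2 → ℝ) (hu : Integrable u) (r : ℝ) (hr : 0 < r) (M : ℝ)
    (H : ∀ φ : E2 → ℝ, ContDiff ℝ (⊤ : ℕ∞) φ → HasCompactSupport φ →
      tsupport φ ⊆ Metric.ball 0 (2 * r) → (∀ y, |φ y| ≤ 1) → ∫ y, u y * φ y ≤ M) :
    ∫ y in Metric.ball 0 r, |u y| ≤ M := by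
  let χ : ContDiffBump (0 : E2) := ⟨r, 3 / 2 * r, hr, by linarith⟩
  have hχi : Integrable (fun y => χ y) := χ.continuous.integrable_of_hasCompactSupport χ.hasCompactSupport
  have hI0 : 0 ≤ ∫ y, χ y := integral_nonneg fun y => χ.nonneg
  have key : ∀ η : ℝ, 0 < η → ∫ y in Metric.ball 0 r, |u y| ≤ M + η * (2 + 3 * ∫ y, χ y) := by
    intro η hη
    obtain ⟨w, hwc, hwd, hwcont, hwi⟩ := hu.exists_hasCompactSupport_integral_sub_le hη
    obtain ⟨k, hk, hkw⟩ :=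
      (hwcont.uniformContinuous_of_tendsto_cocompact
        (hwc.is_zero_at_infty)).exists_contDiff_dist_le hη
    have hpos : ∀ y, 0 < k y ^ 2 + η ^ 2 := fun y => by positivity
    let φ : E2 → ℝ := fun y => χ y * (k y / Real.sqrt (k y ^ 2 + η ^ 2))
    have hφs : ContDiff ℝ (⊤ : ℕ∞) φ := by
      refine χ.contDiff.mul (hk.div (ContDiff.sqrt ?_ fun y => (hpos y).ne') fun y => ?_)
      · exact (hk.pow 2).add contDiff_const
      · exact (Real.sqrt_pos.2 (hpos y)).ne'
    have hφc : HasCompactSupport φ := χ.hasCompactSupport.mul_right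
    have hφt : tsupport φ ⊆ Metric.ball 0 (2 * r) := by
      refine (tsupport_mul_subset_left).trans ?_
      rw [χ.tsupport_eq]
      exact Metric.closedBall_subset_ball (by change 3 / 2 * r < 2 * r; linarith)
    have hle : ∀ y, |k y| ≤ Real.sqrt (k y ^ 2 + η ^ 2) := fun y => by
      apply Real.abs_le_sqrt; nlinarith [sq_nonneg η]
    have hφ1 : ∀ y, |φ y| ≤ 1 := by
      intro y
      have h1 : |k y / Real.sqrt (k y ^ 2 + η ^ 2)| ≤ 1 := by
        rw [abs_div, abs_of_nonneg (Real.sqrt_nonneg _)]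
        exact div_le_one_of_le₀ (hle y) (Real.sqrt_nonneg _)
      rw [abs_mul, abs_of_nonneg χ.nonneg]
      exact mul_le_one₀ χ.le_one (abs_nonneg _) h1
    have hM := H φ hφs hφc hφt hφ1
    have hpt : ∀ y, χ y * |u y| ≤ u y * φ y + 2 * ‖u y - w y‖ + 3 * η * χ y := by
      intro y
      set S := Real.sqrt (k y ^ 2 + η ^ 2) with hS
      have hS0 : 0 < S := Real.sqrt_pos.2 (hpos y)
      have hSS : S ^ 2 = k y ^ 2 + η ^ 2 := Real.sq_sqrt (hpos y).le
      have hSle : S ≤ |k y| + η := by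
        apply Real.sqrt_le_iff.2 ⟨by positivity, ?_⟩
        nlinarith [sq_abs (k y), abs_nonneg (k y)]
      have h1 : |k y| - η ≤ k y * (k y / S) := by
        have : k y * (k y / S) = k y ^ 2 / S := by ring
        rw [this, le_div_iff₀ hS0]
        nlinarith [sq_abs (k y), abs_nonneg (k y), hle y]
      have h2 : |k y / S| ≤ 1 := by
        rw [abs_div, abs_of_nonneg hS0.le]
        exact div_le_one_of_le₀ (hle y) hS0.le
      have h3 : -|u y - k y| ≤ (u y - k y) * (k y / S) := by
        have := neg_abs_le ((u y - k y) * (k y / S))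
        rw [abs_mul] at this
        nlinarith [abs_nonneg (u y - k y)]
      have h4 : |u y - k y| ≤ |u y - w y| + η := by
        have := (hkw y).le
        rw [Real.dist_eq, abs_sub_comm] at this
        have := abs_sub_le (u y) (w y) (k y)
        linarith
      have h5 : |u y| ≤ |k y| + |u y - k y| := by
        have := abs_add_le (k y) (u y - k y)
        simpa using this
      have h6 : |u y| ≤ u y * (k y / S) + 2 * |u y - w y| + 3 * η := by
        nlinarith
      have h7 := mul_le_mul_of_nonneg_left h6 (χ.nonneg (x := y))
      have h8 : χ y * |u y - w y| ≤ |u y - w y| :=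
        mul_le_of_le_one_left (abs_nonneg _) χ.le_one
      change χ y * |u y| ≤ u y * (χ y * (k y / S)) + 2 * |u y - w y| + 3 * η * χ y
      nlinarith
    have hbφ : Integrable (fun y => u y * φ y) :=
      hu.mul_bdd (c := 1) hφs.continuous.aestronglyMeasurable (Eventually.of_forall hφ1)
    have hχu : Integrable (fun y => χ y * |u y|) :=
      hu.abs.bdd_mul χ.continuous.aestronglyMeasurable
        (Eventually.of_forall fun y => by
          rw [Real.norm_eq_abs, abs_of_nonneg χ.nonneg]; exact χ.le_one)
    calc ∫ y in Metric.ball 0 r, |u y| = ∫ y in Metric.ball 0 r, χ y * |u y| := by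
          refine setIntegral_congr_fun measurableSet_ball fun y hy => ?_
          have : χ y = 1 := χ.one_of_mem_closedBall (Metric.ball_subset_closedBall hy)
          simp [this]
      _ ≤ ∫ y, χ y * |u y| := setIntegral_le_integral hχu
          (Eventually.of_forall fun y => mul_nonneg χ.nonneg (abs_nonneg _))
      _ ≤ ∫ y, (u y * φ y + 2 * ‖u y - w y‖ + 3 * η * χ y) :=
          integral_mono hχu ((hbφ.add ((hu.sub hwi).norm.const_mul 2)).add (hχi.const_mul _)) hpt
      _ = (∫ y, u y * φ y) + 2 * (∫ y, ‖u y - w y‖) + 3 * η * ∫ y, χ y := by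
          have i2 : Integrable (fun y => 2 * ‖u y - w y‖) := (hu.sub hwi).norm.const_mul 2
          have i3 : Integrable (fun y => 3 * η * χ y) := hχi.const_mul _
          have i1 : Integrable (fun y => u y * φ y + 2 * ‖u y - w y‖) := hbφ.add i2
          rw [integral_add i1 i3, integral_add hbφ i2, integral_const_mul, integral_const_mul]
      _ ≤ _ := by nlinarith
  by_contra hcon
  push Not at hcon
  set D := (∫ y in Metric.ball 0 r, |u y|) - M with hD
  have hDpos : 0 < D := by linarith
  set I := ∫ y, χ y
  have h1 := key (D / (2 * (2 + 3 * I))) (by positivity)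
  have h2 : D / (2 * (2 + 3 * I)) * (2 + 3 * I) = D / 2 := by field_simp
  linarith

/-- `G` is the weak gradient of `h` on the ball `B_R(0)`. -/
def WeakGrad (h : E2 → ℝ) (G : E2 → E2) (R : ℝ) : Prop :=
  ∀ φ : E2 → ℝ, ContDiff ℝ (⊤ : ℕ∞) φ → HasCompactSupport φ →
    tsupport φ ⊆ Metric.ball 0 R → ∀ i : Fin 2,
    (∫ y, h y * fderiv ℝ φ y (EuclideanSpace.single i 1)) = - ∫ y, G y i * φ y

lemma E2_decomp (y : E2) :
    y = y 0 • EuclideanSpace.single 0 (1 : ℝ) + y 1 • EuclideanSpace.single 1 (1 : ℝ) := by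
  ext i; fin_cases i <;> simp

lemma fderiv_coord_mul (φ : E2 → ℝ) (hφ : ContDiff ℝ (⊤ : ℕ∞) φ) (s : ℝ) (i : Fin 2) (y : E2) :
    fderiv ℝ (fun y : E2 => y i * φ (s • y)) y (EuclideanSpace.single i 1) =
      φ (s • y) + s * (y i * fderiv ℝ φ (s • y) (EuclideanSpace.single i 1)) := by
  have h1 : HasFDerivAt (fun y : E2 => y i) (EuclideanSpace.proj i : E2 →L[ℝ] ℝ) y :=
    (EuclideanSpace.proj i : E2 →L[ℝ] ℝ).hasFDerivAt
  have h2 : HasFDerivAt (fun y : E2 => s • y) (s • ContinuousLinearMap.id ℝ E2) y :=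
    (hasFDerivAt_id y).const_smul s
  have h3 : HasFDerivAt φ (fderiv ℝ φ (s • y)) (s • y) :=
    (hφ.differentiable (by simp) _).hasFDerivAt
  have h4 : HasFDerivAt (fun y : E2 => φ (s • y)) _ y := h3.comp y h2
  have h5 : HasFDerivAt (fun y : E2 => y i * φ (s • y)) _ y := h1.mul h4
  rw [h5.fderiv]
  simp
  ring

lemma tsupport_coord_mul (φ : E2 → ℝ) {ρ s : ℝ} (hφt : tsupport φ ⊆ Metric.ball 0 ρ)
    (hφc : HasCompactSupport φ)
    (hs : 1 ≤ s) (i : Fin 2) : HasCompactSupport (fun y : E2 => y i * φ (s • y)) ∧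
      tsupport (fun y : E2 => y i * φ (s • y)) ⊆ Metric.ball 0 ρ := by
  have hs0 : s ≠ 0 := by positivity
  have hc : HasCompactSupport (fun y : E2 => φ (s • y)) := hφc.comp_smul hs0
  refine ⟨hc.mul_left, (tsupport_mul_subset_right).trans ?_⟩
  have h1 : tsupport (fun y : E2 => φ (s • y)) ⊆ (fun y : E2 => s • y) ⁻¹' tsupport φ :=
    tsupport_comp_subset_preimage φ (continuous_const_smul s)
  intro y hy
  have := hφt (h1 hy)
  simp only [mem_ball_zero_iff, norm_smul, Real.norm_eq_abs, abs_of_pos (by linarith : 0 < s)] at this ⊢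
  nlinarith [norm_nonneg y]

lemma coord_le (v : E2) (i : Fin 2) : |v i| ≤ ‖v‖ := by
  simpa using PiLp.norm_apply_le v i

lemma integrable_coord {G : E2 → E2} (hG : Integrable G) (i : Fin 2) :
    Integrable (fun y => G y i) :=
  (EuclideanSpace.proj i : E2 →L[ℝ] ℝ).integrable_comp hG

lemma inner_E2 (a b : E2) : ⟪a, b⟫ = a 0 * b 0 + a 1 * b 1 := by
  simp [PiLp.inner_apply, Fin.sum_univ_two, mul_comm]

lemma scale_bound (h : E2 → ℝ) (G : E2 → E2) (hh : Integrable h) (hG : Integrable G)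
    (ρ : ℝ) (hρ : 0 < ρ) (hw : WeakGrad h G ρ)
    (φ : E2 → ℝ) (hφ : ContDiff ℝ (⊤ : ℕ∞) φ) (hφc : HasCompactSupport φ)
    (hφt : tsupport φ ⊆ Metric.ball 0 ρ) (hφ1 : ∀ y, |φ y| ≤ 1) :
    ∫ y, (h y - h ((1 / 2 : ℝ) • y)) * φ y ≤ 2 * ρ * ∫ y in Metric.ball 0 ρ, ‖G y‖ := by
  have hφcont := hφ.continuous
  have hφ' : Continuous (fderiv ℝ φ) := hφ.continuous_fderiv (by simp)
  let Φ : E2 → ℝ := fun z => 2 * φ z + fderiv ℝ φ z z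
  have hΦcont : Continuous Φ := by
    exact (hφcont.const_mul 2 |>.add (hφ'.clm_apply continuous_id))
  have hΦc : HasCompactSupport Φ := by
    refine HasCompactSupport.add hφc.mul_left ?_
    refine (hφc.fderiv (𝕜 := ℝ)).mono' ?_
    intro z hz
    apply subset_tsupport
    intro h0
    exact hz (by simp [h0])
  obtain ⟨C, hC⟩ := hΦc.exists_bound_of_continuous hΦcont
  let F : ℝ → E2 → ℝ := fun s y => h y * (s ^ 2 * φ (s • y))
  let F' : ℝ → E2 → ℝ := fun s y => h y * (s * Φ (s • y))
  have hFi : ∀ s, Integrable (F s) := fun s =>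
    hh.mul_bdd (c := s ^ 2) (by fun_prop) (Eventually.of_forall fun y => by
      rw [Real.norm_eq_abs, abs_mul, abs_of_nonneg (sq_nonneg s)]
      exact mul_le_of_le_one_right (sq_nonneg s) (hφ1 _))
  have hsb : ∀ s, Continuous fun y : E2 => s * Φ (s • y) := fun s =>
    continuous_const.mul (hΦcont.comp (continuous_const_smul s))
  have hder : ∀ s ∈ Icc (1 : ℝ) 2,
      Integrable (F' s) ∧ HasDerivAt (fun s => ∫ y, F s y) (∫ y, F' s y) s := by
    intro s hs
    refine hasDerivAt_integral_of_dominated_loc_of_deriv_le (Metric.ball_mem_nhds s one_pos)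
      (bound := fun y => |h y| * (3 * C))
      (Eventually.of_forall fun s => (hFi s).aestronglyMeasurable) (hFi s)
      (hh.aestronglyMeasurable.mul (hsb s).aestronglyMeasurable) ?_ (hh.abs.mul_const _) ?_
    · refine Eventually.of_forall fun y t ht => ?_
      have h1 : |t| ≤ 3 := by
        rw [Metric.mem_ball, Real.dist_eq, abs_lt] at ht
        rw [abs_le]; constructor <;> linarith [ht.1, ht.2, hs.1, hs.2]
      have h2 := hC (t • y)
      simp only [F', norm_mul, Real.norm_eq_abs] at h2 ⊢
      gcongr
    · refine Eventually.of_forall fun y t ht => ?_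
      have h2 : HasDerivAt (fun t : ℝ => t • y) y t := by
        simpa using (hasDerivAt_id t).smul_const y
      have h3 : HasFDerivAt φ (fderiv ℝ φ (t • y)) (t • y) :=
        (hφ.differentiable (by simp) _).hasFDerivAt
      have h4 : HasDerivAt (fun t : ℝ => φ (t • y)) (fderiv ℝ φ (t • y) y) t :=
        h3.comp_hasDerivAt t h2
      have h5 := ((hasDerivAt_pow 2 t).mul h4).const_mul (h y)
      refine HasDerivAt.congr_deriv (f := fun t => F t y) h5 ?_
      simp only [F', Φ, map_smul, smul_eq_mul]
      push_cast
      ring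
  have hval : ∀ s ∈ Icc (1 : ℝ) 2, ‖∫ y, F' s y‖ ≤ 2 * ρ * ∫ y in Metric.ball 0 ρ, ‖G y‖ := by
    intro s hs
    have hs1 : 1 ≤ s := hs.1
    let ψ : Fin 2 → E2 → ℝ := fun i y => y i * φ (s • y)
    have hψs : ∀ i, ContDiff ℝ (⊤ : ℕ∞) (ψ i) := fun i =>
      (EuclideanSpace.proj i : E2 →L[ℝ] ℝ).contDiff.mul (hφ.comp (contDiff_const_smul s))
    have hψ := fun i => tsupport_coord_mul φ hφt hφc hs1 i
    have hwi := fun i => hw (ψ i) (hψs i) (hψ i).1 (hψ i).2 i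
    have hint1 : ∀ i, Integrable (fun y => h y * fderiv ℝ (ψ i) y (EuclideanSpace.single i 1)) := by
      intro i
      have hc : Continuous (fun y => fderiv ℝ (ψ i) y (EuclideanSpace.single i 1)) :=
        ((hψs i).continuous_fderiv (by simp)).clm_apply continuous_const
      obtain ⟨K, hK⟩ := ((hψ i).1.fderiv_apply (𝕜 := ℝ) (EuclideanSpace.single i 1)).exists_bound_of_continuous hc
      exact hh.mul_bdd hc.aestronglyMeasurable (Eventually.of_forall hK)
    have hint2 : ∀ i, Integrable (fun y => G y i * ψ i y) := by
      intro i
      obtain ⟨K, hK⟩ := (hψ i).1.exists_bound_of_continuous (hψs i).continuous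
      exact (integrable_coord hG i).mul_bdd (hψs i).continuous.aestronglyMeasurable
        (Eventually.of_forall hK)
    have e1 : ∫ y, F' s y = s * ((∫ y, h y * fderiv ℝ (ψ 0) y (EuclideanSpace.single 0 1))
        + ∫ y, h y * fderiv ℝ (ψ 1) y (EuclideanSpace.single 1 1)) := by
      rw [← integral_add (hint1 0) (hint1 1), ← integral_const_mul]
      congr 1; ext y
      simp only [ψ, fderiv_coord_mul φ hφ, F', Φ]
      have : fderiv ℝ φ (s • y) (s • y) =
          s * (y 0 * fderiv ℝ φ (s • y) (EuclideanSpace.single 0 1)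
            + y 1 * fderiv ℝ φ (s • y) (EuclideanSpace.single 1 1)) := by
        conv_lhs => rw [map_smul]; arg 2; arg 2; rw [E2_decomp y]
        simp
      rw [this]; ring
    have e2 : ∫ y, F' s y = - (s * ∫ y, ⟪G y, y⟫ * φ (s • y)) := by
      rw [e1, hwi 0, hwi 1, ← neg_add, ← integral_add (hint2 0) (hint2 1), mul_neg]
      congr 3; ext y
      simp only [ψ, inner_E2]; ring
    rw [e2, norm_neg, norm_mul, Real.norm_eq_abs, abs_of_pos (by linarith : 0 < s)]
    have hb : ∀ y, ‖⟪G y, y⟫ * φ (s • y)‖ ≤ (Metric.ball (0 : E2) ρ).indicator (fun y => ρ * ‖G y‖) y := by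
      intro y
      by_cases hy : y ∈ Metric.ball (0 : E2) ρ
      · rw [indicator_of_mem hy, norm_mul]
        have a1 : ‖⟪G y, y⟫‖ ≤ ‖G y‖ * ‖y‖ := norm_inner_le_norm _ _
        have a2 : ‖φ (s • y)‖ ≤ 1 := hφ1 _
        have a3 : ‖y‖ < ρ := by simpa using hy
        calc _ ≤ ‖⟪G y, y⟫‖ * 1 := by gcongr
          _ ≤ ‖G y‖ * ‖y‖ := by linarith
          _ ≤ ‖G y‖ * ρ := by gcongr
          _ = _ := mul_comm _ _
      · have : φ (s • y) = 0 := by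
          apply image_eq_zero_of_notMem_tsupport
          intro hmem
          apply hy
          have := hφt hmem
          simp only [mem_ball_zero_iff, norm_smul, Real.norm_eq_abs, abs_of_pos (by linarith : 0 < s)] at this ⊢
          nlinarith [norm_nonneg y]
        rw [indicator_of_notMem hy, this]; simp
    have hGi : Integrable ((Metric.ball (0 : E2) ρ).indicator (fun y => ρ * ‖G y‖)) :=
      (hG.norm.const_mul ρ).indicator measurableSet_ball
    have b1 := norm_integral_le_of_norm_le hGi (Eventually.of_forall hb)
    rw [integral_indicator measurableSet_ball, integral_const_mul] at b1
    have b0 : 0 ≤ ∫ y in Metric.ball (0 : E2) ρ, ‖G y‖ := integral_nonneg fun y => norm_nonneg _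
    calc s * ‖∫ y, ⟪G y, y⟫ * φ (s • y)‖ ≤ 2 * (ρ * ∫ y in Metric.ball (0 : E2) ρ, ‖G y‖) := by
          gcongr; exact hs.2
      _ = _ := by ring
  have mv := Convex.norm_image_sub_le_of_norm_hasDerivWithin_le
    (fun s hs => (hder s hs).2.hasDerivWithinAt) hval (convex_Icc 1 2)
    (right_mem_Icc.2 (by norm_num : (1 : ℝ) ≤ 2)) (left_mem_Icc.2 (by norm_num))
  have hh2 : Integrable (fun y => h ((1 / 2 : ℝ) • y)) := hh.comp_smul (by norm_num)
  have hb1 : Integrable (fun y => h y * φ y) :=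
    hh.mul_bdd (c := 1) hφcont.aestronglyMeasurable (Eventually.of_forall hφ1)
  have hb2 : Integrable (fun y => h ((1 / 2 : ℝ) • y) * φ y) :=
    hh2.mul_bdd (c := 1) hφcont.aestronglyMeasurable (Eventually.of_forall hφ1)
  have f1 : ∫ y, F 1 y = ∫ y, h y * φ y := by simp [F]
  have f2 : ∫ y, F 2 y = ∫ y, h ((1 / 2 : ℝ) • y) * φ y := by
    have := Measure.integral_comp_smul_of_nonneg (volume : Measure E2)
      (fun y => h ((1 / 2 : ℝ) • y) * φ y) 2 (hR := by norm_num)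
    simp only [finrank_euclideanSpace, Fintype.card_fin, smul_smul, smul_eq_mul] at this
    have e : ∫ y, F 2 y = 4 * ∫ y, h ((1 / 2 * 2 : ℝ) • y) * φ ((2 : ℝ) • y) := by
      rw [← integral_const_mul]
      congr 1; ext y; simp [F]; ring
    rw [e, this]; ring
  calc ∫ y, (h y - h ((1 / 2 : ℝ) • y)) * φ y = (∫ y, F 1 y) - ∫ y, F 2 y := by
        rw [f1, f2, ← integral_sub hb1 hb2]
        congr 1; ext y; ring
    _ ≤ ‖(∫ y, F 1 y) - ∫ y, F 2 y‖ := le_abs_self _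
    _ ≤ _ := by
      refine mv.trans (le_of_eq ?_)
      norm_num

lemma WeakGrad.mono {h : E2 → ℝ} {G : E2 → E2} {R ρ : ℝ} (hw : WeakGrad h G R) (hρ : ρ ≤ R) :
    WeakGrad h G ρ := fun φ h1 h2 h3 i => hw φ h1 h2 (h3.trans (Metric.ball_subset_ball hρ)) i

lemma half_step (h : E2 → ℝ) (G : E2 → E2) (hh : Integrable h) (hG : Integrable G)
    (r : ℝ) (hr : 0 < r) (hw : WeakGrad h G (2 * r)) :
    ∫ y in Metric.ball 0 r, |h y| ≤ 4 * (∫ y in Metric.ball 0 (r / 2), |h y|)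
      + 4 * r * ∫ y in Metric.ball 0 (2 * r), ‖G y‖ := by
  have hh2 : Integrable (fun y => h ((1 / 2 : ℝ) • y)) := hh.comp_smul (by norm_num)
  have h1 := dual_bound (fun y => h y - h ((1 / 2 : ℝ) • y)) (hh.sub hh2) r hr
    (2 * (2 * r) * ∫ y in Metric.ball 0 (2 * r), ‖G y‖)
    (fun φ a b c d => scale_bound h G hh hG (2 * r) (by positivity) hw φ a b c d)
  have h2 : ∫ y in Metric.ball (0 : E2) r, |h ((1 / 2 : ℝ) • y)| =
      4 * ∫ y in Metric.ball 0 (r / 2), |h y| := by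
    rw [Measure.setIntegral_comp_smul_of_pos (volume : Measure E2) (fun y => |h y|)
      (Metric.ball (0 : E2) r) (by norm_num : (0 : ℝ) < 1 / 2),
      _root_.smul_ball (by norm_num : (1 / 2 : ℝ) ≠ 0)]
    simp only [finrank_euclideanSpace, Fintype.card_fin, smul_zero, smul_eq_mul]
    norm_num
    rw [show 1 / 2 * r = r / 2 by ring]
  have h3 : ∫ y in Metric.ball (0 : E2) r, |h y| ≤
      ∫ y in Metric.ball (0 : E2) r, (|h y - h ((1 / 2 : ℝ) • y)| + |h ((1 / 2 : ℝ) • y)|) := by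
    refine integral_mono hh.abs.integrableOn ((hh.sub hh2).abs.add hh2.abs).integrableOn fun y => ?_
    have := abs_add_le (h y - h ((1 / 2 : ℝ) • y)) (h ((1 / 2 : ℝ) • y))
    simpa using this
  have i1 : IntegrableOn (fun y => |h y - h ((1 / 2 : ℝ) • y)|) (Metric.ball (0 : E2) r) :=
    (hh.sub hh2).abs.integrableOn
  rw [integral_add i1 hh2.abs.integrableOn, h2] at h3
  linarith

lemma core (h : E2 → ℝ) (G : E2 → E2) (hh : Integrable h) (hG : Integrable G)
    (R : ℝ) (hR : 0 < R) (hw : WeakGrad h G R)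
    (h2 : Tendsto (fun r : ℝ => (∫ y in Metric.ball 0 r, |h y|) / r ^ 2) (𝓝[>] 0) (𝓝 0))
    (h3 : Tendsto (fun r : ℝ => (∫ y in Metric.ball 0 r, ‖G y‖) / r ^ 3) (𝓝[>] 0) (𝓝 0)) :
    Tendsto (fun r : ℝ => (∫ y in Metric.ball 0 r, |h y|) / r ^ 4) (𝓝[>] 0) (𝓝 0) := by
  rw [Metric.tendsto_nhds]
  intro ε hε
  have hG3 := (Metric.tendsto_nhds.1 h3) (ε / 64) (by positivity)
  rw [eventually_nhdsWithin_iff, Metric.eventually_nhds_iff] at hG3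
  obtain ⟨δ, hδ, hδ'⟩ := hG3
  set a : ℝ → ℝ := fun r => (∫ y in Metric.ball (0 : E2) r, |h y|) / r ^ 2 with ha
  have ind : ∀ k : ℕ, ∀ r, 0 < r → r < min (δ / 2) (R / 2) →
      a r ≤ a (r / 2 ^ k) + 2 * ε / 3 * r ^ 2 := by
    intro k
    induction k with
    | zero => intro r hr _; simp; positivity
    | succ k ih =>
      intro r hr hrm
      have hr1 : r < δ / 2 := hrm.trans_le (min_le_left _ _)
      have hr2 : r < R / 2 := hrm.trans_le (min_le_right _ _)
      have s1 := ih (r / 2) (by positivity) (by linarith)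
      have s2 := half_step h G hh hG r hr (hw.mono (by linarith))
      have s3 := @hδ' (2 * r) (by rw [Real.dist_eq, sub_zero, abs_of_pos (by positivity)]; linarith)
        (by simpa using hr)
      rw [Real.dist_eq, sub_zero] at s3
      have s4 := (le_abs_self _).trans_lt s3
      rw [div_lt_iff₀ (by positivity)] at s4
      have s5 : a r ≤ a (r / 2) + ε / 2 * r ^ 2 := by
        simp only [ha]
        rw [div_le_iff₀ (by positivity)]
        have : ((∫ y in Metric.ball (0 : E2) (r / 2), |h y|) / (r / 2) ^ 2 + ε / 2 * r ^ 2) * r ^ 2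
          = 4 * (∫ y in Metric.ball (0 : E2) (r / 2), |h y|) + ε / 2 * r ^ 4 := by
          field_simp; ring
        rw [this]
        nlinarith
      have : r / 2 / 2 ^ k = r / 2 ^ (k + 1) := by rw [pow_succ]; field_simp
      rw [this] at s1
      nlinarith
  have hfin : ∀ r, 0 < r → r < min (δ / 2) (R / 2) → a r ≤ 2 * ε / 3 * r ^ 2 := by
    intro r hr hrm
    have ht : Tendsto (fun k : ℕ => r / 2 ^ k) atTop (𝓝[>] 0) := by
      rw [tendsto_nhdsWithin_iff]
      refine ⟨?_, Eventually.of_forall fun k => by simp only [mem_Ioi]; positivity⟩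
      have := (tendsto_pow_atTop_nhds_zero_of_lt_one (by norm_num : (0 : ℝ) ≤ 1 / 2)
        (by norm_num)).const_mul r
      simpa [div_eq_mul_inv] using this
    have ht2 := ((h2.comp ht).add_const (2 * ε / 3 * r ^ 2))
    rw [zero_add] at ht2
    exact ge_of_tendsto' ht2 fun k => ind k r hr hrm
  have hm : 0 < min (δ / 2) (R / 2) := by positivity
  filter_upwards [Ioo_mem_nhdsGT hm] with r hr
  have h0 : 0 ≤ (∫ y in Metric.ball (0 : E2) r, |h y|) / r ^ 4 :=
    div_nonneg (integral_nonneg fun y => abs_nonneg _) (by have := hr.1; positivity)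
  rw [Real.dist_eq, sub_zero, abs_of_nonneg h0]
  have hrp : 0 < r := hr.1
  have h5 := hfin r hr.1 hr.2
  have h6 : (∫ y in Metric.ball (0 : E2) r, |h y|) / r ^ 4 = a r / r ^ 2 := by
    simp only [ha]; field_simp
  rw [h6, div_lt_iff₀ (by positivity)]
  nlinarith [pow_pos hrp 2]

/-- the `i`-th partial derivative -/
def pd (i : Fin 2) (φ : E2 → ℝ) (y : E2) : ℝ := fderiv ℝ φ y (EuclideanSpace.single i 1)

lemma pd_smooth {φ : E2 → ℝ} (hφ : ContDiff ℝ (⊤ : ℕ∞) φ) (i : Fin 2) :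
    ContDiff ℝ (⊤ : ℕ∞) (pd i φ) :=
  (hφ.fderiv_right (m := (⊤ : ℕ∞)) (by simp)).clm_apply contDiff_const

lemma pd_compact {φ : E2 → ℝ} (hφ : HasCompactSupport φ) (i : Fin 2) :
    HasCompactSupport (pd i φ) := hφ.fderiv_apply (𝕜 := ℝ) _

lemma pd_tsupport {φ : E2 → ℝ} (i : Fin 2) : tsupport (pd i φ) ⊆ tsupport φ :=
  tsupport_fderiv_apply_subset ℝ _

lemma pd_comm {φ : E2 → ℝ} (hφ : ContDiff ℝ (⊤ : ℕ∞) φ) (i j : Fin 2) (y : E2) :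
    pd i (pd j φ) y = pd j (pd i φ) y := by
  have hd : DifferentiableAt ℝ (fderiv ℝ φ) y :=
    (hφ.fderiv_right (m := (⊤ : ℕ∞)) (by simp)).differentiable (by simp) y
  have e : ∀ i j : Fin 2, pd i (pd j φ) y =
      fderiv ℝ (fderiv ℝ φ) y (EuclideanSpace.single i 1) (EuclideanSpace.single j 1) := by
    intro i j
    have := (hd.hasFDerivAt.clm_apply
      (hasFDerivAt_const (EuclideanSpace.single j (1 : ℝ) : E2) y)).fderiv
    unfold pd
    rw [this]
    simp
  rw [e, e]
  have hs : IsSymmSndFDerivAt ℝ φ y :=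
    hφ.contDiffAt.isSymmSndFDerivAt (by
      rw [minSmoothness_of_isRCLikeNormedField]
      exact WithTop.coe_le_coe.2 (le_top : (2 : ℕ∞) ≤ ⊤))
  exact hs _ _

lemma ibp {q φ : E2 → ℝ} (hq : ContDiff ℝ (⊤ : ℕ∞) q) (hφ : ContDiff ℝ (⊤ : ℕ∞) φ)
    (hc : HasCompactSupport φ) (i : Fin 2) :
    ∫ y, q y * pd i φ y = - ∫ y, pd i q y * φ y := by
  refine integral_mul_fderiv_eq_neg_fderiv_mul_of_integrable ?_ ?_ ?_ ?_ ?_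
  · exact ((pd_smooth hq i).continuous.mul hφ.continuous).integrable_of_hasCompactSupport
      hc.mul_left
  · exact (hq.continuous.mul (pd_smooth hφ i).continuous).integrable_of_hasCompactSupport
      (pd_compact hc i).mul_left
  · exact (hq.continuous.mul hφ.continuous).integrable_of_hasCompactSupport hc.mul_left
  · exact fun y _ => hq.differentiable (by simp) y
  · exact fun y _ => hφ.differentiable (by simp) y

lemma integrable_mul_test {h φ : E2 → ℝ} (hh : Integrable h) (hφ : Continuous φ)
    (hc : HasCompactSupport φ) : Integrable (fun y => h y * φ y) := by
  obtain ⟨K, hK⟩ := hc.exists_bound_of_continuous hφ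
  exact hh.mul_bdd hφ.aestronglyMeasurable (Eventually.of_forall hK)

lemma zero_of_tsupport {φ : E2 → ℝ} {B : Set E2} (h : tsupport φ ⊆ B) {y : E2} (hy : y ∉ B) :
    φ y = 0 := image_eq_zero_of_notMem_tsupport fun h' => hy (h h')

lemma weak_transl (Ω : Set E2) (hΩ : IsOpen Ω) (x : E2) (R : ℝ) (hR : Metric.ball x R ⊆ Ω)
    (f : E2 → ℝ) (g : E2 → E2)
    (hweak : ∀ φ : E2 → ℝ, ContDiff ℝ (⊤ : ℕ∞) φ → HasCompactSupport φ →
      tsupport φ ⊆ Ω → ∀ i : Fin 2,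
      (∫ y in Ω, f y * fderiv ℝ φ y (EuclideanSpace.single i 1)) =
        - ∫ y in Ω, g y i * φ y) :
    WeakGrad ((Metric.ball 0 R).indicator fun y => f (x + y))
      ((Metric.ball 0 R).indicator fun y => g (x + y)) R := by
  intro φ hφ hc ht i
  let ψ : E2 → ℝ := fun z => φ (z - x)
  have hψ : ContDiff ℝ (⊤ : ℕ∞) ψ := hφ.comp (contDiff_id.sub contDiff_const)
  have hψc : HasCompactSupport ψ := hc.comp_homeomorph (Homeomorph.subRight x)
  have hmem : ∀ z, z - x ∈ Metric.ball (0 : E2) R → z ∈ Ω := fun z hz =>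
    hR (by simpa [dist_eq_norm] using hz)
  have hψt : tsupport ψ ⊆ Ω := by
    intro z hz
    have h1 : tsupport ψ ⊆ (fun z : E2 => z - x) ⁻¹' tsupport φ :=
      tsupport_comp_subset_preimage φ (continuous_id.sub continuous_const)
    exact hmem z (ht (h1 hz))
  have key := hweak ψ hψ hψc hψt i
  have hd : ∀ z, fderiv ℝ ψ z = fderiv ℝ φ (z - x) := fun z => fderiv_comp_sub x
  have general : ∀ (k θ : E2 → ℝ), tsupport θ ⊆ Metric.ball 0 R →
      ∫ z in Ω, k z * θ (z - x) = ∫ y, (Metric.ball 0 R).indicator (fun y => k (x + y)) y * θ y := by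
    intro k θ hθ
    rw [← integral_sub_right_eq_self (fun y => (Metric.ball 0 R).indicator (fun y => k (x + y)) y * θ y) x,
      ← integral_indicator hΩ.measurableSet]
    congr 1; ext z
    by_cases hz : z - x ∈ Metric.ball (0 : E2) R
    · rw [indicator_of_mem hz, indicator_of_mem (hmem z hz)]; simp
    · rw [zero_of_tsupport hθ hz, mul_zero]
      by_cases hz' : z ∈ Ω
      · rw [indicator_of_mem hz', zero_of_tsupport hθ hz, mul_zero]
      · rw [indicator_of_notMem hz']
  simp only [hd] at key
  have k1 := general f (pd i φ) ((pd_tsupport i).trans ht)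
  have k2 := general (fun z => g z i) φ ht
  have k3 : ∀ y, (Metric.ball 0 R).indicator (fun y => g (x + y) i) y =
      ((Metric.ball 0 R).indicator (fun y => g (x + y)) y) i := by
    intro y
    by_cases hy : y ∈ Metric.ball (0 : E2) R
    · rw [indicator_of_mem hy, indicator_of_mem hy]
    · rw [indicator_of_notMem hy, indicator_of_notMem hy]; simp
  simp only [k3] at k2
  change ∫ y, _ * pd i φ y = _
  rw [← k1, ← k2]
  exact key

lemma integrable_transl {F : Type*} [NormedAddCommGroup F] (Ω : Set E2) (x : E2) (R : ℝ)
    (hR : Metric.ball x R ⊆ Ω) (f : E2 → F) (hf : IntegrableOn f Ω) :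
    Integrable ((Metric.ball (0 : E2) R).indicator fun y => f (x + y)) := by
  have h1 : Integrable ((Metric.ball x R).indicator f) :=
    (hf.mono_set hR).integrable_indicator measurableSet_ball
  have h2 := h1.comp_add_left x
  refine h2.congr (Eventually.of_forall fun y => ?_)
  by_cases hy : y ∈ Metric.ball (0 : E2) R
  · have : x + y ∈ Metric.ball x R := by simpa using hy
    simp only [indicator_of_mem hy, indicator_of_mem this]
  · have : x + y ∉ Metric.ball x R := by simpa using hy
    simp only [indicator_of_notMem hy, indicator_of_notMem this]

lemma setIntegral_transl (x : E2) (r : ℝ) (k : E2 → ℝ) :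
    ∫ y in Metric.ball 0 r, k (x + y) = ∫ y in Metric.ball x r, k y := by
  rw [← integral_indicator measurableSet_ball, ← integral_indicator measurableSet_ball,
    ← integral_add_left_eq_self ((Metric.ball x r).indicator k) x]
  congr 1; ext y
  by_cases hy : y ∈ Metric.ball (0 : E2) r
  · have : x + y ∈ Metric.ball x r := by simpa using hy
    simp only [indicator_of_mem hy, indicator_of_mem this]
  · have : x + y ∉ Metric.ball x r := by simpa using hy
    simp only [indicator_of_notMem hy, indicator_of_notMem this]

lemma curl_zero (f : E2 → ℝ) (g : E2 → E2) (hg : Integrable g)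
    (R : ℝ) (hR : 0 < R) (hw : WeakGrad f g R) (P0 : E2) (A : E2 →L[ℝ] E2)
    (ht : Tendsto (fun r : ℝ => (∫ y in Metric.ball 0 r, ‖g y - (P0 + A y)‖) / r ^ 3)
      (𝓝[>] 0) (𝓝 0)) :
    A (EuclideanSpace.single 1 1) 0 = A (EuclideanSpace.single 0 1) 1 := by
  let χ : ContDiffBump (0 : E2) := ⟨1 / 2, 3 / 4, by norm_num, by norm_num⟩
  have hχs : ContDiff ℝ (⊤ : ℕ∞) χ := χ.contDiff
  have hχc : HasCompactSupport χ := χ.hasCompactSupport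
  have hχt : tsupport χ ⊆ Metric.ball 0 1 := by
    rw [χ.tsupport_eq]
    exact Metric.closedBall_subset_ball (by change (3 / 4 : ℝ) < 1; norm_num)
  have hI : 0 < ∫ y, χ y := χ.integral_pos
  set I := ∫ y, χ y
  obtain ⟨C0, hC0⟩ := (pd_compact hχc 0).exists_bound_of_continuous (pd_smooth hχs 0).continuous
  obtain ⟨C1, hC1⟩ := (pd_compact hχc 1).exists_bound_of_continuous (pd_smooth hχs 1).continuous
  set κ := A (EuclideanSpace.single 1 1) 0 - A (EuclideanSpace.single 0 1) 1 with hκ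
  have main : ∀ r, 0 < r → r < R →
      |κ| * I ≤ (C0 + C1) * ((∫ y in Metric.ball 0 r, ‖g y - (P0 + A y)‖) / r ^ 3) := by
    intro r hr hrR
    let φ : E2 → ℝ := fun y => χ (r⁻¹ • y)
    have hφ : ContDiff ℝ (⊤ : ℕ∞) φ := hχs.comp (contDiff_const_smul r⁻¹)
    have hφc : HasCompactSupport φ := hχc.comp_smul (inv_ne_zero hr.ne')
    have hball : ∀ y : E2, r⁻¹ • y ∈ Metric.ball (0 : E2) 1 → y ∈ Metric.ball (0 : E2) r := by
      intro y hy
      simp only [mem_ball_zero_iff, norm_smul, norm_inv, Real.norm_eq_abs, abs_of_pos hr] at hy ⊢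
      rwa [inv_mul_lt_one₀ hr] at hy
    have hφt : tsupport φ ⊆ Metric.ball 0 r := by
      intro y hy
      exact hball y (hχt (tsupport_comp_subset_preimage χ (continuous_const_smul r⁻¹) hy))
    have hφR : tsupport φ ⊆ Metric.ball 0 R := hφt.trans (Metric.ball_subset_ball hrR.le)
    have hpd : ∀ i y, pd i φ y = r⁻¹ * pd i χ (r⁻¹ • y) := by
      intro i y
      have h2 : HasFDerivAt (fun y : E2 => r⁻¹ • y) (r⁻¹ • ContinuousLinearMap.id ℝ E2) y :=
        (hasFDerivAt_id y).const_smul r⁻¹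
      have h3 : HasFDerivAt χ (fderiv ℝ χ (r⁻¹ • y)) (r⁻¹ • y) :=
        (hχs.differentiable (by simp) _).hasFDerivAt
      have h4 : HasFDerivAt φ _ y := h3.comp y h2
      unfold pd
      rw [h4.fderiv]; simp
    have hIφ : ∫ y, φ y = r ^ 2 * I := by
      have := Measure.integral_comp_inv_smul_of_nonneg (volume : Measure E2) (fun y => χ y) hr.le
      simpa using this
    have w01 : ∫ y, g y 0 * pd 1 φ y = ∫ y, g y 1 * pd 0 φ y := by
      have a := hw (pd 1 φ) (pd_smooth hφ 1) (pd_compact hφc 1) ((pd_tsupport 1).trans hφR) 0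
      have b := hw (pd 0 φ) (pd_smooth hφ 0) (pd_compact hφc 0) ((pd_tsupport 0).trans hφR) 1
      have c : ∫ y, f y * pd 0 (pd 1 φ) y = ∫ y, f y * pd 1 (pd 0 φ) y := by
        simp only [pd_comm hφ 0 1]
      unfold pd at c a b ⊢
      linarith
    have hLs : ∀ i : Fin 2, ContDiff ℝ (⊤ : ℕ∞) (fun y => (P0 + A y) i) := fun i =>
      (EuclideanSpace.proj i : E2 →L[ℝ] ℝ).contDiff.comp (contDiff_const.add A.contDiff)
    have hLd : ∀ i j y, pd j (fun y => (P0 + A y) i) y = A (EuclideanSpace.single j 1) i := by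
      intro i j y
      have h1 : HasFDerivAt (fun y => P0 + A y) A y := A.hasFDerivAt.const_add P0
      have h2 : HasFDerivAt (fun y => (P0 + A y) i) _ y :=
        (EuclideanSpace.proj i : E2 →L[ℝ] ℝ).hasFDerivAt.comp y h1
      unfold pd
      rw [h2.fderiv]; simp
    have l01 : ∫ y, (P0 + A y) 0 * pd 1 φ y = - (A (EuclideanSpace.single 1 1) 0 * (r ^ 2 * I)) := by
      rw [ibp (hLs 0) hφ hφc 1]
      simp only [hLd]
      rw [integral_const_mul, hIφ]
    have l10 : ∫ y, (P0 + A y) 1 * pd 0 φ y = - (A (EuclideanSpace.single 0 1) 1 * (r ^ 2 * I)) := by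
      rw [ibp (hLs 1) hφ hφc 0]
      simp only [hLd]
      rw [integral_const_mul, hIφ]
    have ig : ∀ i j, Integrable (fun y => g y i * pd j φ y) := fun i j =>
      integrable_mul_test (integrable_coord hg i) (pd_smooth hφ j).continuous (pd_compact hφc j)
    have iL : ∀ i j, Integrable (fun y => (P0 + A y) i * pd j φ y) := fun i j =>
      ((hLs i).continuous.mul (pd_smooth hφ j).continuous).integrable_of_hasCompactSupport
        (pd_compact hφc j).mul_left
    have e1 : ∫ y, ((g y 0 * pd 1 φ y - (P0 + A y) 0 * pd 1 φ y)
        - (g y 1 * pd 0 φ y - (P0 + A y) 1 * pd 0 φ y)) = κ * (r ^ 2 * I) := by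
      have s1 : Integrable (fun y => g y 0 * pd 1 φ y - (P0 + A y) 0 * pd 1 φ y) :=
        (ig 0 1).sub (iL 0 1)
      have s2 : Integrable (fun y => g y 1 * pd 0 φ y - (P0 + A y) 1 * pd 0 φ y) :=
        (ig 1 0).sub (iL 1 0)
      rw [integral_sub s1 s2,
        integral_sub (ig 0 1) (iL 0 1), integral_sub (ig 1 0) (iL 1 0), w01, l01, l10, hκ]
      ring
    have hDi : IntegrableOn (fun y => ‖g y - (P0 + A y)‖) (Metric.ball 0 r) := by
      refine (hg.integrableOn.sub ?_).norm
      exact ((continuous_const.add A.continuous).continuousOn.integrableOn_compact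
        (isCompact_closedBall 0 r)).mono_set Metric.ball_subset_closedBall
    have hind : Integrable ((Metric.ball (0 : E2) r).indicator
        (fun y => (C0 + C1) * r⁻¹ * ‖g y - (P0 + A y)‖)) :=
      IntegrableOn.integrable_indicator (hDi.const_mul _) measurableSet_ball
    have hb : ∀ y, ‖(g y 0 * pd 1 φ y - (P0 + A y) 0 * pd 1 φ y)
        - (g y 1 * pd 0 φ y - (P0 + A y) 1 * pd 0 φ y)‖ ≤
        (Metric.ball (0 : E2) r).indicator (fun y => (C0 + C1) * r⁻¹ * ‖g y - (P0 + A y)‖) y := by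
      intro y
      by_cases hy : y ∈ Metric.ball (0 : E2) r
      · rw [indicator_of_mem hy]
        have d0 := coord_le (g y - (P0 + A y)) 0
        have d1 := coord_le (g y - (P0 + A y)) 1
        have c0 : |pd 0 φ y| ≤ C0 * r⁻¹ := by
          rw [hpd, abs_mul, abs_of_pos (inv_pos.2 hr), mul_comm]
          have := hC0 (r⁻¹ • y)
          rw [Real.norm_eq_abs] at this
          gcongr
        have c1 : |pd 1 φ y| ≤ C1 * r⁻¹ := by
          rw [hpd, abs_mul, abs_of_pos (inv_pos.2 hr), mul_comm]
          have := hC1 (r⁻¹ • y)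
          rw [Real.norm_eq_abs] at this
          gcongr
        have e : (g y 0 * pd 1 φ y - (P0 + A y) 0 * pd 1 φ y)
            - (g y 1 * pd 0 φ y - (P0 + A y) 1 * pd 0 φ y) =
            (g y - (P0 + A y)) 0 * pd 1 φ y - (g y - (P0 + A y)) 1 * pd 0 φ y := by
          simp only [PiLp.sub_apply]; ring
        rw [e, Real.norm_eq_abs]
        refine (abs_sub _ _).trans ?_
        rw [abs_mul, abs_mul]
        have n0 := norm_nonneg (g y - (P0 + A y))
        calc _ ≤ ‖g y - (P0 + A y)‖ * (C1 * r⁻¹) + ‖g y - (P0 + A y)‖ * (C0 * r⁻¹) := by gcongr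
          _ = _ := by ring
      · rw [indicator_of_notMem hy, zero_of_tsupport ((pd_tsupport 0).trans hφt) hy,
          zero_of_tsupport ((pd_tsupport 1).trans hφt) hy]
        simp
    have b1 := norm_integral_le_of_norm_le hind (Eventually.of_forall hb)
    rw [e1, integral_indicator measurableSet_ball, integral_const_mul, norm_mul,
      Real.norm_eq_abs, Real.norm_eq_abs, abs_of_pos (by positivity : 0 < r ^ 2 * I)] at b1
    have b2 : |κ| * I * r ^ 2 ≤ (C0 + C1) * ((∫ y in Metric.ball 0 r, ‖g y - (P0 + A y)‖) / r ^ 3) * r ^ 2 := by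
      refine le_of_eq_of_le (by ring) (b1.trans (le_of_eq ?_))
      field_simp
    exact le_of_mul_le_mul_right b2 (by positivity)
  have hlim := ht.const_mul (C0 + C1)
  rw [mul_zero] at hlim
  have hle : |κ| * I ≤ 0 := by
    refine ge_of_tendsto hlim ?_
    filter_upwards [Ioo_mem_nhdsGT hR] with r hr
    exact main r hr.1 hr.2
  have : |κ| = 0 := by nlinarith [abs_nonneg κ]
  have := abs_eq_zero.1 this
  linarith

lemma ind_apply {B : Set E2} (L : E2 → E2) (y : E2) (i : Fin 2) :
    (B.indicator L y) i = B.indicator (fun y => L y i) y := by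
  by_cases hy : y ∈ B
  · rw [indicator_of_mem hy, indicator_of_mem hy]
  · rw [indicator_of_notMem hy, indicator_of_notMem hy]; simp

lemma ind_mul_test {B : Set E2} {φ : E2 → ℝ} (k : E2 → ℝ) (h : tsupport φ ⊆ B) (y : E2) :
    B.indicator k y * φ y = k y * φ y := by
  by_cases hy : y ∈ B
  · rw [indicator_of_mem hy]
  · rw [zero_of_tsupport h hy, mul_zero, mul_zero]

lemma weak_sub (f : E2 → ℝ) (g : E2 → E2) (hf : Integrable f) (hg : Integrable g) (R : ℝ)
    (hw : WeakGrad f g R) (q : E2 → ℝ) (L : E2 → E2) (hq : ContDiff ℝ (⊤ : ℕ∞) q)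
    (hL : Continuous L) (hqL : ∀ i y, pd i q y = L y i) :
    WeakGrad (fun y => f y - (Metric.ball 0 R).indicator q y)
      (fun y => g y - (Metric.ball 0 R).indicator L y) R := by
  intro φ hφ hc ht i
  change ∫ y, _ * pd i φ y = _
  have ht' := (pd_tsupport (φ := φ) i).trans ht
  have hLi : Continuous fun y => L y i :=
    (EuclideanSpace.proj i : E2 →L[ℝ] ℝ).continuous.comp hL
  have a : ∀ y, (f y - (Metric.ball 0 R).indicator q y) * pd i φ y =
      f y * pd i φ y - q y * pd i φ y := fun y => by rw [sub_mul, ind_mul_test q ht']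
  have b : ∀ y, (g y - (Metric.ball 0 R).indicator L y) i * φ y =
      g y i * φ y - L y i * φ y := fun y => by
    rw [PiLp.sub_apply, ind_apply, sub_mul, ind_mul_test (fun y => L y i) ht]
  simp only [a, b]
  rw [integral_sub, integral_sub, ibp hq hφ hc i]
  · simp only [hqL]
    have := hw φ hφ hc ht i
    unfold pd
    rw [this]; ring
  · exact integrable_mul_test (integrable_coord hg i) hφ.continuous hc
  · exact (hLi.mul hφ.continuous).integrable_of_hasCompactSupport hc.mul_left
  · exact integrable_mul_test hf (pd_smooth hφ i).continuous (pd_compact hc i)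
  · exact (hq.continuous.mul (pd_smooth hφ i).continuous).integrable_of_hasCompactSupport
      (pd_compact hc i).mul_left

lemma integrable_ind {F : Type*} [NormedAddCommGroup F] {L : E2 → F} (hL : Continuous L) (R : ℝ) :
    Integrable ((Metric.ball (0 : E2) R).indicator L) :=
  IntegrableOn.integrable_indicator ((hL.continuousOn.integrableOn_compact
    (isCompact_closedBall 0 R)).mono_set Metric.ball_subset_closedBall) measurableSet_ball

lemma quad_hasGradientAt (c₀ : ℝ) (w : E2) (A : E2 →L[ℝ] E2) (hA : ∀ a b, ⟪A a, b⟫ = ⟪a, A b⟫)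
    (y : E2) :
    HasGradientAt (fun y : E2 => c₀ + ⟪w, y⟫ + ⟪y, ((1 / 2 : ℝ) • A) y⟫) (w + A y) y := by
  rw [hasGradientAt_iff_hasFDerivAt]
  have h1 : HasFDerivAt (fun y : E2 => ⟪w, y⟫) (innerSL ℝ w) y := (innerSL ℝ w).hasFDerivAt
  have h2 : HasFDerivAt (fun y : E2 => ⟪y, ((1 / 2 : ℝ) • A) y⟫) _ y :=
    (hasFDerivAt_id y).inner ℝ ((1 / 2 : ℝ) • A).hasFDerivAt
  have h3 := (h1.const_add c₀).add h2
  refine HasFDerivAt.congr_fderiv (f := fun y : E2 => c₀ + ⟪w, y⟫ + ⟪y, ((1 / 2 : ℝ) • A) y⟫) h3 ?_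
  ext b
  have e := hA y b
  have e' : ⟪b, A y⟫ = ⟪A y, b⟫ := real_inner_comm _ _
  simp [fderivInnerCLM_apply, inner_add_left, inner_smul_right, e', e]
  ring

lemma symm_of_entries (A : E2 →L[ℝ] E2)
    (h : A (EuclideanSpace.single 1 1) 0 = A (EuclideanSpace.single 0 1) 1) (a b : E2) :
    ⟪A a, b⟫ = ⟪a, A b⟫ := by
  have e : ∀ a : E2, A a = a 0 • A (EuclideanSpace.single 0 1) + a 1 • A (EuclideanSpace.single 1 1) := by
    intro a
    conv_lhs => rw [E2_decomp a]
    simp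
  rw [e a, e b, inner_E2, inner_E2]
  simp only [PiLp.add_apply, PiLp.smul_apply, smul_eq_mul]
  rw [h]; ring

lemma quad_smooth (c₀ : ℝ) (w : E2) (A : E2 →L[ℝ] E2) :
    ContDiff ℝ (⊤ : ℕ∞) (fun y : E2 => c₀ + ⟪w, y⟫ + ⟪y, ((1 / 2 : ℝ) • A) y⟫) :=
  (contDiff_const.add (contDiff_const.inner ℝ contDiff_id)).add
    (contDiff_id.inner ℝ ((1 / 2 : ℝ) • A).contDiff)

lemma pd_of_gradient {q : E2 → ℝ} {y p : E2} (h : HasGradientAt q p y) (i : Fin 2) :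
    pd i q y = p i := by
  unfold pd
  rw [(hasGradientAt_iff_hasFDerivAt.1 h).fderiv]
  simp [inner_E2]
  fin_cases i <;> simp

/-- A function bounded by `K ‖y‖` near `0` has small averages. -/
lemma small_avg (d : E2 → ℝ) (hd : Continuous d) (K : ℝ) (hK : 0 ≤ K)
    (hb : ∀ y : E2, ‖y‖ < 1 → |d y| ≤ K * ‖y‖) :
    Tendsto (fun r : ℝ => (∫ y in Metric.ball 0 r, |d y|) / r ^ 2) (𝓝[>] 0) (𝓝 0) := by
  set V := (volume (Metric.ball (0 : E2) 1)).toReal with hV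
  have hup : Tendsto (fun r : ℝ => K * V * r) (𝓝[>] 0) (𝓝 0) := by
    have : Tendsto (fun r : ℝ => K * V * r) (𝓝 0) (𝓝 (K * V * 0)) :=
      (continuous_const.mul continuous_id).tendsto 0
    rw [mul_zero] at this
    exact this.mono_left nhdsWithin_le_nhds
  refine tendsto_of_tendsto_of_tendsto_of_le_of_le' tendsto_const_nhds hup ?_ ?_
  · filter_upwards with r
    exact div_nonneg (integral_nonneg fun y => abs_nonneg _) (sq_nonneg r)
  · filter_upwards [Ioo_mem_nhdsGT one_pos] with r hr
    have hr0 : 0 < r := hr.1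
    have h1 : ‖∫ y in Metric.ball (0 : E2) r, |d y|‖ ≤ (K * r) * volume.real (Metric.ball (0 : E2) r) := by
      refine norm_setIntegral_le_of_norm_le_const measure_ball_lt_top fun y hy => ?_
      have hy' : ‖y‖ < r := by simpa using hy
      rw [Real.norm_eq_abs, abs_abs]
      exact (hb y (hy'.trans hr.2)).trans (by gcongr)
    have h2 : volume.real (Metric.ball (0 : E2) r) = r ^ 2 * V := by
      rw [measureReal_def, Measure.addHaar_ball_of_pos _ _ hr0]
      simp [hV, ENNReal.toReal_mul, ENNReal.toReal_ofReal (sq_nonneg r)]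
    rw [h2] at h1
    rw [div_le_iff₀ (by positivity)]
    calc _ ≤ _ := le_abs_self _
      _ ≤ _ := h1
      _ = _ := by ring

/-- **Second-order approximate differentiability from first-order data.**
Let `Ω ⊆ ℝ²` be open, `x ∈ Ω`, and let `f ∈ L¹(Ω)` have weak gradient `g ∈ L¹(Ω;ℝ²)`.
If `f ∈ t^{1,1}(x)` (approximation by a degree ≤ 1 polynomial with error `o(r)`) and
`g ∈ t^{1,1}(x)` (approximation by an affine map `P` with error `o(r)`), then
`f ∈ t^{2,1}(x)`: there is a degree ≤ 2 polynomial `q` approximating `f` with error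
`o(r²)` and with `∇q = P` everywhere. -/
theorem t11_to_t21
    (Ω : Set (EuclideanSpace ℝ (Fin 2))) (hΩ : IsOpen Ω)
    (x : EuclideanSpace ℝ (Fin 2)) (hx : x ∈ Ω)
    (f : EuclideanSpace ℝ (Fin 2) → ℝ) (hf : IntegrableOn f Ω)
    (g : EuclideanSpace ℝ (Fin 2) → EuclideanSpace ℝ (Fin 2)) (hg : IntegrableOn g Ω)
    (hweak : ∀ φ : EuclideanSpace ℝ (Fin 2) → ℝ, ContDiff ℝ (⊤ : ℕ∞) φ → HasCompactSupport φ →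
      tsupport φ ⊆ Ω → ∀ i : Fin 2,
      (∫ y in Ω, f y * fderiv ℝ φ y (EuclideanSpace.single i 1)) =
        - ∫ y in Ω, g y i * φ y)
    (c : ℝ) (v : EuclideanSpace ℝ (Fin 2))
    (hf11 : Tendsto (fun r : ℝ =>
        (∫ y in Metric.ball x r, |f y - (c + ⟪v, y⟫)|) / r ^ 3)
      (𝓝[>] 0) (𝓝 0))
    (P : EuclideanSpace ℝ (Fin 2) → EuclideanSpace ℝ (Fin 2))
    (hPaff : ∃ (w : EuclideanSpace ℝ (Fin 2))
        (A : EuclideanSpace ℝ (Fin 2) →L[ℝ] EuclideanSpace ℝ (Fin 2)),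
        P = fun y => w + A y)
    (hg11 : Tendsto (fun r : ℝ =>
        (∫ y in Metric.ball x r, ‖g y - P y‖) / r ^ 3)
      (𝓝[>] 0) (𝓝 0)) :
    ∃ q : EuclideanSpace ℝ (Fin 2) → ℝ,
      (∃ (c₀ : ℝ) (v₀ : EuclideanSpace ℝ (Fin 2))
          (A₀ : EuclideanSpace ℝ (Fin 2) →L[ℝ] EuclideanSpace ℝ (Fin 2)),
          q = fun y => c₀ + ⟪v₀, y⟫ + ⟪y, A₀ y⟫) ∧
      Tendsto (fun r : ℝ => (∫ y in Metric.ball x r, |f y - q y|) / r ^ 4)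
        (𝓝[>] 0) (𝓝 0) ∧
      ∀ y, HasGradientAt q (P y) y := by
  obtain ⟨w, A, rfl⟩ := hPaff
  obtain ⟨R, hR, hRΩ⟩ := Metric.isOpen_iff.1 hΩ x hx
  set ft : E2 → ℝ := (Metric.ball (0 : E2) R).indicator fun y => f (x + y) with hft
  set gt : E2 → E2 := (Metric.ball (0 : E2) R).indicator fun y => g (x + y) with hgt
  have hfti : Integrable ft := integrable_transl Ω x R hRΩ f hf
  have hgti : Integrable gt := integrable_transl Ω x R hRΩ g hg
  have hwk : WeakGrad ft gt R := weak_transl Ω hΩ x R hRΩ f g hweak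
  have hmemR : ∀ r, r < R → ∀ y ∈ Metric.ball (0 : E2) r, y ∈ Metric.ball (0 : E2) R :=
    fun r hr y hy => Metric.ball_subset_ball hr.le hy
  -- symmetry of `A`
  have hcurl : Tendsto (fun r : ℝ => (∫ y in Metric.ball 0 r, ‖gt y - ((w + A x) + A y)‖) / r ^ 3)
      (𝓝[>] 0) (𝓝 0) := by
    refine hg11.congr' ?_
    filter_upwards [Ioo_mem_nhdsGT hR] with r hr
    rw [← setIntegral_transl x r]
    congr 1
    refine setIntegral_congr_fun measurableSet_ball fun y hy => ?_
    simp only [hgt, indicator_of_mem (hmemR r hr.2 y hy), map_add, add_assoc]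
  have hA := symm_of_entries A (curl_zero ft gt hgti R hR hwk (w + A x) A hcurl)
  set c₀ : ℝ := c + ⟪v, x⟫ - ⟪w, x⟫ - ⟪x, ((1 / 2 : ℝ) • A) x⟫ with hc₀
  set q : E2 → ℝ := fun y => c₀ + ⟪w, y⟫ + ⟪y, ((1 / 2 : ℝ) • A) y⟫ with hq
  have hgrad : ∀ y, HasGradientAt q (w + A y) y := quad_hasGradientAt c₀ w A hA
  set qt : E2 → ℝ := fun y => (c + ⟪v, x⟫) + ⟪w + A x, y⟫ + ⟪y, ((1 / 2 : ℝ) • A) y⟫ with hqt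
  have hqq : ∀ y, q (x + y) = qt y := by
    intro y
    have e1 : ⟪y, A x⟫ = ⟪A x, y⟫ := real_inner_comm _ _
    have e2 := hA x y
    simp only [hq, hqt, hc₀, inner_add_left, inner_add_right, map_add,
      ContinuousLinearMap.smul_apply, inner_smul_right, e1, ← e2]
    ring
  have hqts : ContDiff ℝ (⊤ : ℕ∞) qt := quad_smooth _ _ A
  have hLc : Continuous fun y => (w + A x) + A y := continuous_const.add A.continuous
  set h : E2 → ℝ := fun y => ft y - (Metric.ball 0 R).indicator qt y with hh
  set G : E2 → E2 := fun y => gt y - (Metric.ball 0 R).indicator (fun y => (w + A x) + A y) y with hG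
  have hwG : WeakGrad h G R := weak_sub ft gt hfti hgti R hwk qt _ hqts hLc
    fun i y => pd_of_gradient (quad_hasGradientAt _ _ A hA y) i
  have hhi : Integrable h := hfti.sub (integrable_ind hqts.continuous R)
  have hGi : Integrable G := hgti.sub (integrable_ind hLc R)
  have hheq : ∀ r, r < R → ∀ y ∈ Metric.ball (0 : E2) r, h y = f (x + y) - q (x + y) := by
    intro r hr y hy
    simp only [hh, hft, indicator_of_mem (hmemR r hr y hy), hqq]
  have hG3 : Tendsto (fun r : ℝ => (∫ y in Metric.ball 0 r, ‖G y‖) / r ^ 3) (𝓝[>] 0) (𝓝 0) := by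
    refine hcurl.congr' ?_
    filter_upwards [Ioo_mem_nhdsGT hR] with r hr
    congr 1
    refine setIntegral_congr_fun measurableSet_ball fun y hy => ?_
    simp only [hG, indicator_of_mem (hmemR r hr.2 y hy)]
  -- the zeroth order information
  set d : E2 → ℝ := fun y => (c + ⟪v, x + y⟫) - qt y with hd
  have hdc : Continuous d := by
    refine Continuous.sub ?_ hqts.continuous
    exact continuous_const.add (continuous_const.inner (continuous_const.add continuous_id))
  have hdb : ∀ y : E2, ‖y‖ < 1 → |d y| ≤ (‖v - (w + A x)‖ + ‖A‖) * ‖y‖ := by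
    intro y hy
    have e : d y = ⟪v - (w + A x), y⟫ - (1 / 2) * ⟪y, A y⟫ := by
      simp only [hd, hqt, inner_sub_left, inner_add_right, ContinuousLinearMap.smul_apply,
        inner_smul_right]
      ring
    have e1 := abs_real_inner_le_norm (v - (w + A x)) y
    have e2 := abs_real_inner_le_norm y (A y)
    have e3 := A.le_opNorm y
    have e4 : ‖y‖ * ‖A y‖ ≤ 1 * (‖A‖ * ‖y‖) := by gcongr
    have e5 : |1 / 2 * ⟪y, A y⟫| = 1 / 2 * |⟪y, A y⟫| := by
      rw [abs_mul]; norm_num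
    have e6 := abs_sub (⟪v - (w + A x), y⟫) (1 / 2 * ⟪y, A y⟫)
    have e7 := abs_nonneg ⟪y, A y⟫
    rw [e]
    rw [e5] at e6
    linarith
  have hd2 := small_avg d hdc _ (by positivity) hdb
  have hp2 : Tendsto (fun r : ℝ =>
      (∫ y in Metric.ball x r, |f y - (c + ⟪v, y⟫)|) / r ^ 2) (𝓝[>] 0) (𝓝 0) := by
    have hid : Tendsto (fun r : ℝ => r) (𝓝[>] 0) (𝓝 0) := nhdsWithin_le_nhds
    have := hf11.mul hid
    rw [mul_zero] at this
    refine this.congr' ?_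
    filter_upwards [self_mem_nhdsWithin] with r hr
    have : r ≠ 0 := ne_of_gt hr
    field_simp
  have hh2 : Tendsto (fun r : ℝ => (∫ y in Metric.ball 0 r, |h y|) / r ^ 2) (𝓝[>] 0) (𝓝 0) := by
    have hsum := hp2.add hd2
    rw [add_zero] at hsum
    refine tendsto_of_tendsto_of_tendsto_of_le_of_le' tendsto_const_nhds hsum ?_ ?_
    · filter_upwards with r
      exact div_nonneg (integral_nonneg fun y => abs_nonneg _) (sq_nonneg r)
    · filter_upwards [Ioo_mem_nhdsGT hR] with r hr
      have hr0 : 0 < r := hr.1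
      rw [← add_div]
      refine div_le_div_of_nonneg_right ?_ (by positivity)
      have hdi : IntegrableOn d (Metric.ball 0 r) :=
        (hdc.continuousOn.integrableOn_compact
          (isCompact_closedBall 0 r)).mono_set Metric.ball_subset_closedBall
      have hfd : IntegrableOn (fun y => f (x + y) - (c + ⟪v, x + y⟫)) (Metric.ball 0 r) := by
        refine (hhi.integrableOn.sub hdi).congr_fun ?_ measurableSet_ball
        intro y hy
        simp only [Pi.sub_apply, hheq r hr.2 y hy, hqq, hd]
        ring
      rw [← setIntegral_transl x r, ← integral_add hfd.abs hdi.abs]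
      refine setIntegral_mono_on hhi.abs.integrableOn (hfd.abs.add hdi.abs) measurableSet_ball ?_
      intro y hy
      rw [hheq r hr.2 y hy, hqq]
      have := abs_add_le (f (x + y) - (c + ⟪v, x + y⟫)) (d y)
      simpa [hd] using this
  have hfinal := core h G hhi hGi R hR hwG hh2 hG3
  refine ⟨q, ⟨c₀, w, (1 / 2 : ℝ) • A, rfl⟩, ?_, hgrad⟩
  refine hfinal.congr' ?_
  filter_upwards [Ioo_mem_nhdsGT hR] with r hr
  rw [← setIntegral_transl x r]
  congr 1
  refine setIntegral_congr_fun measurableSet_ball fun y hy => ?_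
  simp only [hheq r hr.2 y hy]
end
end
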